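/- Let p be an odd prime, F an algebraically closed field of characteristic p, and C_p a cyclic subgroup of 𝔖_p of order p. Then Ind_{C_p}^{𝔖_p} F ≅ F ⊕ Ω²(F) ⊕ Ω⁴(F) ⊕ ⋯ ⊕ Ω^{2p−4}(F) ⊕ P for some projective F𝔖_p-module P. -/

import Mathlib

open CategoryTheory

variable {A : Type} [Ring A]

/-- `N` has no nonzero projective direct summand. -/
def noProjSummand (N : ModuleCat.{0} A) : Prop :=
  ∀ Q : Submodule A N, (∃ R : Submodule A N, IsCompl Q R) → Module.Projective A Q → Q = ⊥

/-- `N` is (isomorphic to) the projective-free part `Ω⁰(M)` of `M`. -/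
def isStableRep (M N : ModuleCat.{0} A) : Prop :=
  noProjSummand N ∧
    ∃ P : ModuleCat.{0} A, Module.Projective A P ∧ Nonempty (↥M ≃ₗ[A] (↥N × ↥P))

/-- `K` is (isomorphic to) the Heller translate `Ω(M)`: the kernel of a projective
cover of `M`. -/
def isSyzygy (M K : ModuleCat.{0} A) : Prop :=
  ∃ (P : ModuleCat.{0} A) (π : ↥P →ₗ[A] ↥M),
    Module.Projective A P ∧ Function.Surjective π ∧
    (∀ Q : Submodule A P, Q ⊔ LinearMap.ker π = ⊤ → Q = ⊤) ∧
    Nonempty (↥K ≃ₗ[A] ↥(LinearMap.ker π))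

/-- `N ≅ Ω^n(M)`, where `Ω⁰` takes the projective-free part. -/
def isOmegaPow : ℕ → ModuleCat.{0} A → ModuleCat.{0} A → Prop
  | 0, M, N => isStableRep M N
  | n + 1, M, N => ∃ K : ModuleCat.{0} A, isSyzygy M K ∧ isOmegaPow n K N

/-- `N ≅ Ω^i(M)` for `i : ℤ`; for negative `i` this is expressed by saying that `N` is
projective-free and `Ω^{-i}(N) ≅ Ω⁰(M)`. -/
def isOmegaZPow (i : ℤ) (M N : ModuleCat.{0} A) : Prop :=
  if 0 ≤ i then isOmegaPow i.toNat M N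
  else noProjSummand N ∧ ∃ M₀ : ModuleCat.{0} A, isOmegaPow 0 M M₀ ∧ isOmegaPow (-i).toNat N M₀

/-- `M` is periodic with period exactly `n`: `n` is the least positive integer with
`Ω^n(M) ≅ Ω⁰(M) ≠ 0`. -/
def hasPeriod (M : ModuleCat.{0} A) (n : ℕ) : Prop :=
  0 < n ∧ (∃ N : ModuleCat.{0} A, Nontrivial N ∧ isOmegaPow 0 M N ∧ isOmegaPow n M N) ∧
    ∀ m, 0 < m → m < n → ¬ ∃ N : ModuleCat.{0} A, isOmegaPow 0 M N ∧ isOmegaPow m M N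

section AbstractModules

theorem split_equiv {M N : Type} [AddCommGroup M] [Module A M] [AddCommGroup N] [Module A N]
    (f : M →ₗ[A] N) (g : N →ₗ[A] M) (h : ∀ x, f (g x) = x) :
    Nonempty (M ≃ₗ[A] (N × LinearMap.ker f)) := by
  refine ⟨LinearEquiv.ofLinearMap
    (f.prod (LinearMap.codRestrict _ (LinearMap.id - g.comp f) (fun x => by simp [h])))
    (g.coprod (LinearMap.ker f).subtype) ?_ ?_⟩
  · ext x
    · simp [h]
    · simp [h]
    · simp
    · have := x.2
      simp
  · ext x
    simp

theorem cover_exists [IsArtinianRing A] (M : Type) [AddCommGroup M] [Module A M]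
    [Module.Finite A M] :
    ∃ (P : ModuleCat.{0} A) (π : ↥P →ₗ[A] M),
    Module.Projective A P ∧ Module.Finite A P ∧ Function.Surjective π ∧
    (∀ Q : Submodule A P, Q ⊔ LinearMap.ker π = ⊤ → Q = ⊤) := by
  obtain ⟨n, f, hf⟩ := Module.Finite.exists_fin' A M
  let S : Set (Submodule A (Fin n → A)) := {N | Module.Projective A N ∧ N.map f = ⊤}
  have hS : S.Nonempty := ⟨⊤, by
    refine ⟨Module.Projective.of_equiv (Submodule.topEquiv (R := A) (M := Fin n → A)).symm, ?_⟩
    rw [Submodule.map_top, LinearMap.range_eq_top]; exact hf⟩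
  obtain ⟨N, hN, hmin⟩ := (wellFounded_lt (α := Submodule A (Fin n → A))).has_min S hS
  obtain ⟨hNp, hNf⟩ := hN
  have hsurj : Function.Surjective (f.comp N.subtype) := by
    rw [← LinearMap.range_eq_top, LinearMap.range_comp, Submodule.range_subtype, hNf]
  refine ⟨ModuleCat.of A N, f.comp N.subtype, hNp, inferInstanceAs (Module.Finite A N), hsurj, ?_⟩
  intro Q hQ
  change Submodule A N at Q
  -- lift
  have hQs : Function.Surjective ((f.comp N.subtype).comp Q.subtype) := by
    intro m
    obtain ⟨x, rfl⟩ := hsurj m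
    have hx : x ∈ Q ⊔ LinearMap.ker (f.comp N.subtype) := by
      have : x ∈ (⊤ : Submodule A N) := trivial
      rw [← hQ] at this; exact this
    obtain ⟨y, hy, z, hz, rfl⟩ := Submodule.mem_sup.1 hx
    refine ⟨⟨y, hy⟩, ?_⟩
    rw [LinearMap.mem_ker] at hz
    rw [map_add, hz, add_zero]; rfl
  obtain ⟨l, hl⟩ := Module.projective_lifting_property _ (f.comp N.subtype) hQs
  let φ : Module.End A N := Q.subtype.comp l
  have hφ : ∀ x, f.comp N.subtype (φ x) = f.comp N.subtype x := fun x => LinearMap.congr_fun hl x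
  have hφn : ∀ k x, f.comp N.subtype ((φ ^ k) x) = f.comp N.subtype x := by
    intro k
    induction k with
    | zero => intro x; simp
    | succ k ih => intro x; rw [pow_succ', Module.End.mul_apply, hφ, ih]
  obtain ⟨k, hk⟩ := Filter.eventually_atTop.1 φ.eventually_isCompl_ker_pow_range_pow
  have hk1 := hk (k+1) (by omega)
  have hproj : Module.Projective A (LinearMap.range (φ ^ (k+1))) := by
    have e := Submodule.prodEquivOfIsCompl _ _ hk1
    refine Module.Projective.of_split ((LinearMap.range (φ ^ (k+1))).subtype)
      ((LinearMap.snd _ _ _).comp (Submodule.prodEquivOfIsCompl _ _ hk1).symm.toLinearMap) ?_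
    ext x
    simp
  let N' := (LinearMap.range (φ ^ (k+1))).map N.subtype
  have hN' : N' ∈ S := by
    refine ⟨?_, ?_⟩
    · exact Module.Projective.of_equiv (Submodule.equivMapOfInjective N.subtype
        N.injective_subtype (LinearMap.range (φ ^ (k+1))))
    · rw [eq_top_iff]
      intro m _
      obtain ⟨x, rfl⟩ := hsurj m
      exact ⟨((φ^(k+1)) x : N), ⟨_, ⟨x, rfl⟩, rfl⟩, hφn _ x⟩
  have hle : N' ≤ N := by
    rintro _ ⟨x, _, rfl⟩; exact x.2
  have hEq : N' = N := by
    by_contra hne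
    exact hmin N' hN' (lt_of_le_of_ne hle hne)
  rw [eq_top_iff]
  intro x _
  have : (x : Fin n → A) ∈ N' := by rw [hEq]; exact x.2
  obtain ⟨y, ⟨z, rfl⟩, hy⟩ := this
  have : x = (φ^(k+1)) z := Subtype.ext hy.symm
  rw [this, pow_succ', Module.End.mul_apply]
  exact (l _).2

/-- projective submodules are direct summands -/
def ProjSubSplit (A : Type) [Ring A] : Prop :=
  ∀ (P : Type) [AddCommGroup P] [Module A P] (Q : Submodule A P), Module.Projective A Q →
    ∃ r : P →ₗ[A] Q, ∀ x : Q, r x = x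

theorem syzygy_noProj (hA : ProjSubSplit A) {M : Type} [AddCommGroup M] [Module A M]
    (P : Type) [AddCommGroup P] [Module A P] (π : P →ₗ[A] M)
    (hπ : ∀ Q : Submodule A P, Q ⊔ LinearMap.ker π = ⊤ → Q = ⊤) :
    noProjSummand (ModuleCat.of A (LinearMap.ker π)) := by
  intro Q _ hQ
  change Submodule A (LinearMap.ker π) at Q
  let Q' := Q.map (LinearMap.ker π).subtype
  have hQ' : Module.Projective A Q' := Module.Projective.of_equiv
    (Submodule.equivMapOfInjective (LinearMap.ker π).subtype
        (LinearMap.ker π).injective_subtype Q)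
  obtain ⟨r, hr⟩ := hA P Q' hQ'
  have htop := hπ (LinearMap.ker r) (by
    rw [eq_top_iff]
    intro x _
    have h1 : x = (x - r x) + r x := by abel
    rw [h1]
    refine Submodule.add_mem_sup ?_ ?_
    · simp [hr]
    · obtain ⟨y, _, hy⟩ := (r x).2
      rw [← hy]; exact y.2)
  rw [eq_bot_iff]
  intro x hx
  have hxQ : (x : P) ∈ Q' := ⟨x, hx, rfl⟩
  have h2 : (x : P) ∈ LinearMap.ker r := by rw [htop]; trivial
  have h3 := hr ⟨x, hxQ⟩
  rw [LinearMap.mem_ker] at h2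
  rw [h2] at h3
  have : (x : P) = 0 := (congrArg Subtype.val h3).symm
  rw [Submodule.mem_bot]
  exact Subtype.ext this

theorem kernel_step [IsArtinianRing A] (hA : ProjSubSplit A)
    {M M0 P1 P : Type} [AddCommGroup M] [Module A M] [AddCommGroup M0] [Module A M0]
    [AddCommGroup P1] [Module A P1] [AddCommGroup P] [Module A P]
    (e : M ≃ₗ[A] (M0 × P1)) [Module.Projective A P1] [Module.Projective A P] [Module.Finite A P]
    (π : P →ₗ[A] M) (hπ : Function.Surjective π) :
    ∃ (K P2 : ModuleCat.{0} A), isSyzygy (ModuleCat.of A M0) K ∧ noProjSummand K ∧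
      Module.Projective A P2 ∧ Nonempty (LinearMap.ker π ≃ₗ[A] (K × P2)) := by
  let a : P →ₗ[A] M0 := (LinearMap.fst A M0 P1).comp (e.toLinearMap.comp π)
  let b : P →ₗ[A] P1 := (LinearMap.snd A M0 P1).comp (e.toLinearMap.comp π)
  have hb : Function.Surjective b :=
    Prod.snd_surjective.comp (e.surjective.comp hπ)
  have ha : Function.Surjective a :=
    Prod.fst_surjective.comp (e.surjective.comp hπ)
  haveI : Module.Finite A M0 := Module.Finite.of_surjective a ha
  obtain ⟨sb, hsb⟩ := Module.projective_lifting_property b LinearMap.id hb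
  have hsb' : ∀ x, b (sb x) = x := fun x => LinearMap.congr_fun hsb x
  -- projectivity of ker b
  haveI hKb : Module.Projective A (LinearMap.ker b) := by
    refine Module.Projective.of_split (LinearMap.ker b).subtype
      (LinearMap.codRestrict _ (LinearMap.id - sb.comp b) (fun x => by simp [hsb'])) ?_
    ext x
    simp
  let c : LinearMap.ker b →ₗ[A] M0 := a.comp (LinearMap.ker b).subtype
  have hc : Function.Surjective c := by
    intro m
    obtain ⟨x, hx⟩ := (e.surjective.comp hπ) (m, 0)
    refine ⟨⟨x, ?_⟩, ?_⟩
    · rw [LinearMap.mem_ker]; exact congrArg Prod.snd hx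
    · exact congrArg Prod.fst hx
  obtain ⟨P0, π0, hP0, _, hs0, hsup⟩ := cover_exists (A := A) M0
  obtain ⟨l, hl⟩ := Module.projective_lifting_property π0 c hs0
  have hl' : ∀ x, π0 (l x) = c x := fun x => LinearMap.congr_fun hl x
  have hls : Function.Surjective l := by
    rw [← LinearMap.range_eq_top]
    apply hsup
    rw [eq_top_iff]
    intro x _
    obtain ⟨y, hy⟩ := hc (π0 x)
    have h1 : x = l y + (x - l y) := by abel
    rw [h1]
    refine Submodule.add_mem_sup ⟨y, rfl⟩ ?_
    rw [LinearMap.mem_ker, map_sub, hl', hy, sub_self]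
  obtain ⟨s, hs⟩ := Module.projective_lifting_property l LinearMap.id hls
  have hs' : ∀ x, l (s x) = x := fun x => LinearMap.congr_fun hs x
  -- the kernel of l is projective
  have hKl : Module.Projective A (LinearMap.ker l) := by
    refine Module.Projective.of_split (LinearMap.ker l).subtype
      (LinearMap.codRestrict _ (LinearMap.id - s.comp l) (fun x => by simp [hs'])) ?_
    ext x
    simp
  -- restricted maps
  have hkc : ∀ x : LinearMap.ker π, (x : P) ∈ LinearMap.ker b := by
    rintro ⟨x, hx⟩
    rw [LinearMap.mem_ker] at hx
    simp [b, hx]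
  have hcl : ∀ (x : P) (hx : x ∈ LinearMap.ker b), c ⟨x, hx⟩ = 0 → π x = 0 := by
    intro x hx h
    apply e.injective
    rw [map_zero]
    exact Prod.ext h hx
  let f : LinearMap.ker π →ₗ[A] LinearMap.ker π0 :=
    LinearMap.codRestrict _ (l.comp (LinearMap.codRestrict (LinearMap.ker b)
      (LinearMap.ker π).subtype hkc)) (by
        intro x
        rw [LinearMap.mem_ker, LinearMap.comp_apply, hl']
        have := x.2
        rw [LinearMap.mem_ker] at this
        change (e (π x)).1 = 0
        rw [this, map_zero]; rfl)
  let g : LinearMap.ker π0 →ₗ[A] LinearMap.ker π :=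
    LinearMap.codRestrict _ ((LinearMap.ker b).subtype.comp (s.comp (LinearMap.ker π0).subtype)) (by
      intro x
      rw [LinearMap.mem_ker]
      refine hcl _ (s x).2 ?_
      have := x.2
      rw [LinearMap.mem_ker] at this
      change c (s x) = 0
      rw [← hl', hs', this])
  have hfg : ∀ x, f (g x) = x := by
    intro x
    apply Subtype.ext
    exact hs' x
  obtain ⟨E⟩ := split_equiv f g hfg
  -- ker f ≃ ker l
  let d : LinearMap.ker f →ₗ[A] LinearMap.ker l :=
    LinearMap.codRestrict _ ((LinearMap.codRestrict (LinearMap.ker b)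
      (LinearMap.ker π).subtype hkc).comp (LinearMap.ker f).subtype) (by
        intro x
        have := x.2
        rw [LinearMap.mem_ker] at this ⊢
        exact congrArg Subtype.val this)
  have hd : Function.Bijective d := by
    constructor
    · intro x y hxy
      apply Subtype.ext
      apply Subtype.ext
      exact congrArg (fun z : LinearMap.ker l => ((z : LinearMap.ker b) : P)) hxy
    · rintro ⟨⟨x, hx⟩, hx2⟩
      rw [LinearMap.mem_ker] at hx2
      have h0 : π x = 0 := hcl x hx (by rw [← hl', hx2, map_zero])
      refine ⟨⟨⟨x, h0⟩, ?_⟩, rfl⟩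
      rw [LinearMap.mem_ker]
      exact Subtype.ext hx2
  have hKf : Module.Projective A (LinearMap.ker f) :=
    Module.Projective.of_equiv (LinearEquiv.ofBijective d hd).symm
  exact ⟨ModuleCat.of A (LinearMap.ker π0), ModuleCat.of A (LinearMap.ker f),
    ⟨P0, π0, hP0, hs0, hsup, ⟨LinearEquiv.refl A _⟩⟩, syzygy_noProj hA P0 π0 hsup, hKf, ⟨E⟩⟩

/-- strict chain of syzygies -/
def syzChain : ℕ → ModuleCat.{0} A → ModuleCat.{0} A → Prop
  | 0, M, N => M = N
  | n + 1, M, N => ∃ K : ModuleCat.{0} A, isSyzygy M K ∧ syzChain n K N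

theorem syzChain_snoc (n : ℕ) : ∀ (M K K' : ModuleCat.{0} A), syzChain n M K → isSyzygy K K' →
    syzChain (n + 1) M K' := by
  induction n with
  | zero => rintro M K K' rfl h; exact ⟨K', h, rfl⟩
  | succ n ih =>
    rintro M K K' ⟨L, hL, hLK⟩ h
    exact ⟨L, hL, ih L K K' hLK h⟩

theorem syzChain_omega (n : ℕ) : ∀ (M K : ModuleCat.{0} A), syzChain n M K → noProjSummand K →
    isOmegaPow n M K := by
  induction n with
  | zero =>
    rintro M K rfl h
    refine ⟨h, ModuleCat.of A PUnit, inferInstanceAs (Module.Projective A PUnit), ?_⟩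
    exact ⟨LinearEquiv.prodUnique.symm⟩
  | succ n ih =>
    rintro M K ⟨L, hL, hLK⟩ h
    exact ⟨L, hL, ih L K hLK h⟩

end AbstractModules

section Higman

open MonoidAlgebra

theorem higman_proj {k G M : Type} [Field k] [Group G] [Fintype G] [AddCommGroup M] [Module k M]
    [Module (MonoidAlgebra k G) M] [IsScalarTower k (MonoidAlgebra k G) M] (θ : M →ₗ[k] M)
    (h : ∀ x, ∑ g : G, θ.conjugate g x = x) : Module.Projective (MonoidAlgebra k G) M := by
  let f : (M →₀ MonoidAlgebra k G) →ₗ[MonoidAlgebra k G] M :=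
    Finsupp.linearCombination (MonoidAlgebra k G) id
  have hf : Function.Surjective f := Finsupp.linearCombination_id_surjective _ _
  obtain ⟨s, hs⟩ := LinearMap.exists_rightInverse_of_surjective (f.restrictScalars k)
    (LinearMap.range_eq_top.2 hf)
  have hs' : ∀ x, f (s x) = x := fun x => LinearMap.congr_fun hs x
  refine Module.Projective.of_split ((s.comp θ).sumOfConjugatesEquivariant G) f ?_
  ext x
  rw [LinearMap.comp_apply, LinearMap.sumOfConjugatesEquivariant_apply, map_sum]
  conv_rhs => rw [LinearMap.id_apply, ← h x]
  refine Finset.sum_congr rfl fun g _ => ?_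
  rw [LinearMap.conjugate_apply, LinearMap.conjugate_apply, map_smul, LinearMap.comp_apply, hs']

theorem regular_trace {k G : Type} [Field k] [Group G] [Fintype G] (x : MonoidAlgebra k G) :
    ∑ g : G, (single g⁻¹ (1 : k)) * (single 1 ((single g (1:k) * x).coeff 1)) = x := by
  classical
  ext h
  rw [MonoidAlgebra.coeff_sum, Finsupp.finsetSum_apply]
  rw [Finset.sum_eq_single h⁻¹]
  · simp
  · intro b _ hb
    rw [single_mul_single, MonoidAlgebra.coeff_single, Finsupp.single_apply, if_neg]
    rintro rfl
    simp at hb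
  · simp

theorem proj_higman {k G M : Type} [Field k] [Group G] [Fintype G] [AddCommGroup M] [Module k M]
    [Module (MonoidAlgebra k G) M] [IsScalarTower k (MonoidAlgebra k G) M]
    (h : Module.Projective (MonoidAlgebra k G) M) :
    ∃ θ : M →ₗ[k] M, ∀ x, ∑ g : G, θ.conjugate g x = x := by
  obtain ⟨s, hs⟩ := h.out
  let f : (M →₀ MonoidAlgebra k G) →ₗ[MonoidAlgebra k G] M :=
    Finsupp.linearCombination (MonoidAlgebra k G) id
  let ε : MonoidAlgebra k G →ₗ[k] MonoidAlgebra k G :=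
    { toFun := fun x => single 1 (x.coeff 1)
      map_add' := by intro x y; simp
      map_smul' := by intro c x; simp }
  let θ0 : (M →₀ MonoidAlgebra k G) →ₗ[k] (M →₀ MonoidAlgebra k G) := Finsupp.mapRange.linearMap ε
  refine ⟨(f.restrictScalars k).comp (θ0.comp (s.restrictScalars k)), fun x => ?_⟩
  have h0 : ∀ y, ∑ g : G, θ0.conjugate g y = y := by
    intro y
    ext1 m
    rw [Finsupp.finsetSum_apply]
    exact regular_trace (y m)
  have h1 : ∀ g : G, ((f.restrictScalars k).comp (θ0.comp (s.restrictScalars k))).conjugate g x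
      = f (θ0.conjugate g (s x)) := by
    intro g
    simp only [LinearMap.conjugate_apply, LinearMap.comp_apply, LinearMap.restrictScalars_apply,
      map_smul]
  simp_rw [h1]
  rw [← map_sum, h0]
  exact hs x

theorem projSubSplit_aux {k G : Type} [Field k] [Group G] [Fintype G]
    (P : Type) [AddCommGroup P] [Module k P] [Module (MonoidAlgebra k G) P]
    [IsScalarTower k (MonoidAlgebra k G) P] (Q : Submodule (MonoidAlgebra k G) P)
    (hQ : Module.Projective (MonoidAlgebra k G) Q) :
    ∃ r : P →ₗ[MonoidAlgebra k G] Q, ∀ x : Q, r x = x := by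
  obtain ⟨θ, hθ⟩ := proj_higman (k := k) hQ
  obtain ⟨r, hr⟩ := LinearMap.exists_leftInverse_of_injective (Q.subtype.restrictScalars k)
    (LinearMap.ker_eq_bot.2 Q.injective_subtype)
  have hr' : ∀ x : Q, r x = x := fun x => LinearMap.congr_fun hr x
  refine ⟨(θ.comp r).sumOfConjugatesEquivariant G, fun x => ?_⟩
  rw [LinearMap.sumOfConjugatesEquivariant_apply]
  conv_rhs => rw [← hθ x]
  refine Finset.sum_congr rfl fun g _ => ?_
  rw [LinearMap.conjugate_apply, LinearMap.conjugate_apply, LinearMap.comp_apply,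
    ← Submodule.coe_smul, hr']

theorem projSubSplit_group {k G : Type} [Field k] [Group G] [Fintype G] :
    ProjSubSplit (MonoidAlgebra k G) := by
  intro P _ _ Q hQ
  let : Module k P := .compHom P (algebraMap k (MonoidAlgebra k G))
  have : IsScalarTower k (MonoidAlgebra k G) P := ⟨fun a b c => by
    rw [Algebra.smul_def, mul_smul]; rfl⟩
  exact projSubSplit_aux P Q hQ

theorem trivial_noProj {k G : Type} [Field k] [Group G] [Fintype G]
    (h : (Fintype.card G : k) = 0) :
    noProjSummand (ModuleCat.of (MonoidAlgebra k G)
            (Representation.trivial k (G := G) (V := k)).asModule) := by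
  intro Q _ hQ
  change Submodule (MonoidAlgebra k G) (Representation.trivial k (G := G) (V := k)).asModule at Q
  obtain ⟨θ, hθ⟩ := proj_higman (k := k) hQ
  have hact : ∀ (g : G) (x : Q), single g (1 : k) • x = x := by
    intro g x
    apply Subtype.ext
    rw [Submodule.coe_smul, Representation.single_smul]
    simp
    rfl
  rw [eq_bot_iff]
  intro x hx
  have := hθ ⟨x, hx⟩
  simp only [LinearMap.conjugate_apply, hact] at this
  rw [Finset.sum_const, Finset.card_univ, ← Nat.cast_smul_eq_nsmul k, h, zero_smul] at this
  exact (congrArg Subtype.val this).symm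

end Higman

section Operators

set_option linter.unusedSectionVars false

variable (p : ℕ) [hp : Fact p.Prime] (k : Type) [Field k] [CharP k p]

noncomputable def upoly : Polynomial k :=
  ∑ i : (ZMod p)ˣ, Polynomial.C (ZMod.castHom (dvd_refl p) k ((i⁻¹ : (ZMod p)ˣ) : ZMod p)) *
    Polynomial.X ^ ((i : ZMod p).val)

theorem sum_units_inv_zero (hodd : Odd p) : ∑ i : (ZMod p)ˣ, ((i⁻¹ : (ZMod p)ˣ) : ZMod p) = 0 := by
  have h1 : ∑ i : (ZMod p)ˣ, ((i⁻¹ : (ZMod p)ˣ) : ZMod p) = ∑ i : (ZMod p)ˣ, (i : ZMod p) :=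
    Fintype.sum_equiv (Equiv.inv _) _ _ (fun _ => rfl)
  have h2 : ∑ i : (ZMod p)ˣ, (i : ZMod p) = ∑ i : (ZMod p)ˣ, -(i : ZMod p) :=
    Fintype.sum_equiv (Equiv.neg _) _ _ (fun _ => by simp)
  rw [Finset.sum_neg_distrib] at h2
  rw [h1]
  have h3 : (2 : ZMod p) * ∑ i : (ZMod p)ˣ, (i : ZMod p) = 0 := by
    linear_combination h2
  rcases mul_eq_zero.1 h3 with h | h
  · exfalso
    have h4 : ((2 : ℕ) : ZMod p) = 0 := by exact_mod_cast h
    rw [ZMod.natCast_eq_zero_iff] at h4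
    have := (Nat.prime_dvd_prime_iff_eq hp.out Nat.prime_two).1 h4
    subst this
    exact absurd hodd (by decide)
  · exact h

theorem upoly_eval (hodd : Odd p) : (upoly p k).eval 1 = 0 := by
  rw [upoly, Polynomial.eval_finsetSum]
  simp only [Polynomial.eval_mul, Polynomial.eval_C, Polynomial.eval_pow, Polynomial.eval_X,
    one_pow, mul_one]
  rw [← map_sum, sum_units_inv_zero p hodd, map_zero]

theorem upoly_deriv : (Polynomial.derivative (upoly p k)).eval 1 = -1 := by
  rw [upoly, Polynomial.derivative_sum, Polynomial.eval_finsetSum]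
  have h : ∀ i : (ZMod p)ˣ, (Polynomial.derivative
      (Polynomial.C (ZMod.castHom (dvd_refl p) k ((i⁻¹ : (ZMod p)ˣ) : ZMod p)) *
    Polynomial.X ^ ((i : ZMod p).val))).eval 1 = 1 := by
    intro i
    have h2 : (((i : ZMod p).val : ℕ) : k) = ZMod.castHom (dvd_refl p) k (i : ZMod p) := by
      rw [← map_natCast (ZMod.castHom (dvd_refl p) k), ZMod.natCast_zmod_val]
    simp only [Polynomial.derivative_C_mul, Polynomial.derivative_X_pow, Polynomial.eval_mul,
      Polynomial.eval_C, Polynomial.eval_pow, Polynomial.eval_X, one_pow, mul_one]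
    rw [h2, ← map_mul, Units.inv_mul, map_one]
  rw [Finset.sum_congr rfl (fun i _ => h i), Finset.sum_const, Finset.card_univ,
    ZMod.card_units_eq_totient, Nat.totient_prime hp.out, nsmul_eq_mul, mul_one,
    Nat.cast_sub hp.out.one_le, CharP.cast_eq_zero]
  simp

theorem upoly_factor (hodd : Odd p) : ∃ q a b : Polynomial k,
    upoly p k = (Polynomial.X - 1) * q ∧ a * q + b * (Polynomial.X ^ p - 1) = 1 := by
  obtain ⟨q, hq⟩ := Polynomial.dvd_iff_isRoot.2 (upoly_eval p k hodd)
  rw [Polynomial.C_1] at hq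
  have hq1 : q.eval 1 = -1 := by
    have := upoly_deriv p k
    rw [hq] at this
    simpa using this
  have hcop : IsCoprime q (Polynomial.X - 1) := by
    obtain ⟨r, hr⟩ := Polynomial.dvd_iff_isRoot.2
      (show (q - Polynomial.C (q.eval 1)).IsRoot 1 by simp)
    rw [hq1, Polynomial.C_1] at hr
    refine ⟨-1, r, ?_⟩
    rw [map_neg, Polynomial.C_1] at hr
    linear_combination -hr
  have h2 : IsCoprime q (Polynomial.X ^ p - 1) := by
    have h3 : (Polynomial.X ^ p - 1 : Polynomial k) = (Polynomial.X - 1) ^ p := by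
      rw [sub_pow_char, one_pow]
    rw [h3]
    exact hcop.pow_right
  obtain ⟨a, b, hab⟩ := h2
  exact ⟨q, a, b, hq, hab⟩

variable {R : Type} [Ring R] [Algebra k R]

noncomputable def uop (S : R) : R := Polynomial.aeval S (upoly p k)

def nop (S : R) : R := ∑ i ∈ Finset.range p, S ^ i

theorem uop_eq (S : R) : uop p k S = ∑ i : (ZMod p)ˣ,
    (ZMod.castHom (dvd_refl p) k ((i⁻¹ : (ZMod p)ˣ) : ZMod p)) • S ^ ((i : ZMod p).val) := by
  rw [uop, upoly, map_sum]
  refine Finset.sum_congr rfl fun i _ => ?_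
  rw [map_mul, Polynomial.aeval_C, map_pow, Polynomial.aeval_X, Algebra.smul_def]

theorem uop_factor (hodd : Odd p) (S : R) (hS : S ^ p = 1) : ∃ W W' : R,
    uop p k S = W * (S - 1) ∧ uop p k S * W' = S - 1 ∧ W' * uop p k S = S - 1 := by
  obtain ⟨q, a, b, hq, hab⟩ := upoly_factor p k hodd
  have h1 : Polynomial.aeval S a * Polynomial.aeval S q = 1 := by
    have := congrArg (Polynomial.aeval S) hab
    simpa [hS] using this
  refine ⟨Polynomial.aeval S q, Polynomial.aeval S a, ?_, ?_, ?_⟩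
  · rw [uop, hq, mul_comm]; simp
  · rw [uop, ← map_mul, hq, mul_assoc, mul_comm q a, map_mul, map_mul, h1]; simp
  · rw [uop, ← map_mul, hq, mul_left_comm, map_mul, map_mul, h1]; simp

theorem nop_mul_sub (S : R) (hS : S ^ p = 1) : nop p S * (S - 1) = 0 := by
  rw [nop, geom_sum_mul, hS, sub_self]

theorem nop_mul_uop (hodd : Odd p) (S : R) (hS : S ^ p = 1) : nop p S * uop p k S = 0 := by
  obtain ⟨q, a, b, hq, hab⟩ := upoly_factor p k hodd
  rw [uop, hq, map_mul, ← mul_assoc, map_sub, Polynomial.aeval_X, map_one, nop_mul_sub p S hS,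
    zero_mul]

theorem pow_val (S : R) (hS : S ^ p = 1) (n : ℕ) : S ^ ((n : ZMod p).val) = S ^ n := by
  rw [ZMod.val_natCast, ← pow_eq_pow_mod n hS]

theorem conj_pow_aux (S T : R) (a : ℕ) (h : S * T = T * S ^ a) (i : ℕ) :
    S ^ i * T = T * S ^ (a * i) := by
  induction i with
  | zero => simp
  | succ i ih => rw [pow_succ, mul_assoc, h, ← mul_assoc, ih, mul_assoc, ← pow_add]; rfl

theorem uop_conj (S T : R) (hS : S ^ p = 1) (a : (ZMod p)ˣ)
    (h : S * T = T * S ^ (a : ZMod p).val) :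
    uop p k S * T = (ZMod.castHom (dvd_refl p) k (a : ZMod p)) • (T * uop p k S) := by
  rw [uop_eq, Finset.sum_mul, Finset.mul_sum, Finset.smul_sum]
  refine Fintype.sum_equiv (Equiv.mulLeft a) _ _ fun i => ?_
  rw [smul_mul_assoc, conj_pow_aux S T _ h, Equiv.coe_mulLeft, mul_smul_comm, smul_smul, ← map_mul]
  congr 1
  · rw [mul_inv, Units.val_mul, Units.mul_inv_cancel_left]
  · rw [← pow_val p S hS ((a : ZMod p).val * (i : ZMod p).val)]
    simp

theorem nop_eq (S : R) : nop p S = ∑ i : ZMod p, S ^ i.val := by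
  rw [nop]
  symm
  refine Finset.sum_bij (fun i _ => i.val) ?_ ?_ ?_ ?_
  · intro i _; exact Finset.mem_range.2 (ZMod.val_lt i)
  · intro i _ j _ h; exact ZMod.val_injective p h
  · intro b hb; exact ⟨b, Finset.mem_univ _, ZMod.val_cast_of_lt (Finset.mem_range.1 hb)⟩
  · intros; rfl

theorem nop_conj (S T : R) (hS : S ^ p = 1) (a : (ZMod p)ˣ)
    (h : S * T = T * S ^ (a : ZMod p).val) :
    nop p S * T = T * nop p S := by
  rw [nop_eq, Finset.sum_mul, Finset.mul_sum]
  refine Fintype.sum_equiv (Units.mulLeft a) _ _ fun i => ?_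
  rw [conj_pow_aux S T _ h, Units.mulLeft_apply, ← pow_val p S hS ((a : ZMod p).val * i.val)]
  simp

noncomputable def eop (ζ : k) (T : R) (m : ℕ) : R :=
  ((p - 1 : ℕ) : k)⁻¹ • ∑ j ∈ Finset.range (p - 1), ((ζ ^ m)⁻¹) ^ j • T ^ j

theorem eop_nop (ζ : k) (S T : R) (h : nop p S * T = T * nop p S) (m : ℕ) :
    eop p k ζ T m * nop p S = nop p S * eop p k ζ T m := by
  have hc : Commute (nop p S) T := h
  rw [eop, smul_mul_assoc, mul_smul_comm, Finset.sum_mul, Finset.mul_sum]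
  congr 1
  refine Finset.sum_congr rfl fun j _ => ?_
  rw [smul_mul_assoc, mul_smul_comm, (hc.pow_right j).eq]

theorem eop_uop (ζ : k) (hζ : ζ ≠ 0) (U T : R) (h : U * T = ζ • (T * U)) (m : ℕ) :
    eop p k ζ T m * U = U * eop p k ζ T (m + 1) := by
  have hj : ∀ j : ℕ, T ^ j * U = (ζ⁻¹) ^ j • (U * T ^ j) := by
    intro j
    induction j with
    | zero => simp
    | succ j ih =>
      have h2 : T * U = ζ⁻¹ • (U * T) := by rw [h, smul_smul, inv_mul_cancel₀ hζ, one_smul]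
      rw [pow_succ, mul_assoc, h2, mul_smul_comm, ← mul_assoc, ih, smul_mul_assoc, smul_smul,
        mul_assoc, ← pow_succ, ← pow_succ']
  rw [eop, eop, smul_mul_assoc, mul_smul_comm, Finset.sum_mul, Finset.mul_sum]
  congr 1
  refine Finset.sum_congr rfl fun j _ => ?_
  rw [smul_mul_assoc, hj, mul_smul_comm, smul_smul, ← mul_pow, ← mul_inv, ← pow_succ]

theorem mul_eop (ζ : k) (hζ : ζ ≠ 0) (hζ1 : ζ ^ (p - 1) = 1) (T : R) (hT : T ^ (p - 1) = 1)
    (m : ℕ) : T * eop p k ζ T m = ζ ^ m • eop p k ζ T m := by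
  set η := (ζ ^ m)⁻¹ with hη
  have hη1 : η ^ (p - 1) = 1 := by
    rw [hη, inv_pow, ← pow_mul, mul_comm, pow_mul, hζ1, one_pow, inv_one]
  have hη0 : η ≠ 0 := inv_ne_zero (pow_ne_zero _ hζ)
  have hy : ζ ^ m = η⁻¹ := by rw [hη, inv_inv]
  have h1 : ∀ j, η ^ j • T ^ j = (η • T) ^ j := fun j => (smul_pow _ _ _).symm
  have h2 : (η • T) * ∑ j ∈ Finset.range (p - 1), (η • T) ^ j
      = ∑ j ∈ Finset.range (p - 1), (η • T) ^ j := by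
    have := mul_geom_sum (η • T) (p - 1)
    rw [smul_pow, hη1, hT, one_smul, sub_self, sub_mul, one_mul, sub_eq_zero] at this
    exact this
  rw [eop, ← hη, hy, Finset.sum_congr rfl (fun j _ => h1 j), mul_smul_comm, smul_comm]
  congr 1
  conv_rhs => rw [← h2]
  rw [smul_mul_assoc, smul_smul, inv_mul_cancel₀ hη0, one_smul]

theorem geom_zero (n : ℕ) (η : k) (h1 : η ≠ 1) (hn : η ^ n = 1) :
    ∑ j ∈ Finset.range n, η ^ j = 0 := by
  have := mul_geom_sum η n
  rw [hn, sub_self] at this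
  exact (mul_eq_zero.1 this).resolve_left (sub_ne_zero.2 h1)

theorem pm1_ne : ((p - 1 : ℕ) : k) ≠ 0 := by
  rw [Nat.cast_sub hp.out.one_le, CharP.cast_eq_zero]
  simp

theorem sum_eop (ζ : k) (hζ : IsPrimitiveRoot ζ (p - 1)) (T : R) :
    ∑ m ∈ Finset.range (p - 1), eop p k ζ T m = 1 := by
  have hpos : 0 < p - 1 := by have := hp.out.two_le; omega
  have hζ0 : ζ ≠ 0 := hζ.ne_zero (by omega)
  unfold eop
  rw [← Finset.smul_sum, Finset.sum_comm]
  have h : ∀ j ∈ Finset.range (p - 1),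
      ∑ m ∈ Finset.range (p - 1), ((ζ ^ m)⁻¹) ^ j • T ^ j =
      if j = 0 then ((p - 1 : ℕ) : k) • (1 : R) else 0 := by
    intro j hj
    rw [← Finset.sum_smul]
    split_ifs with h0
    · subst h0; simp
    · have h1 : ∀ m, ((ζ ^ m)⁻¹) ^ j = ((ζ ^ j)⁻¹) ^ m := by
        intro m; rw [inv_pow, inv_pow, ← pow_mul, ← pow_mul, mul_comm]
      rw [Finset.sum_congr rfl (fun m _ => h1 m), geom_zero k, zero_smul]
      · intro h2
        rw [inv_eq_one] at h2
        exact hζ.pow_ne_one_of_pos_of_lt h0 (Finset.mem_range.1 hj) h2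
      · rw [inv_pow, ← pow_mul, mul_comm, pow_mul, hζ.pow_eq_one, one_pow, inv_one]
  rw [Finset.sum_congr rfl h, Finset.sum_ite_eq' , if_pos (Finset.mem_range.2 hpos), smul_smul,
    inv_mul_cancel₀ (pm1_ne p k), one_smul]

end Operators

section OperatorModules

variable (p : ℕ) [hp : Fact p.Prime] (k : Type) [Field k] [CharP k p] [Algebra k A]
  {M : Type} [AddCommGroup M] [Module A M] [Module k M] [IsScalarTower k A M]

def ysub (ζ : k) (T : Module.End A M) (m : ℕ) : Submodule A M :=
  LinearMap.ker (T - ζ ^ m • (1 : Module.End A M))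

def xsub (ζ : k) (S T : Module.End A M) (m : ℕ) : Submodule A M :=
  LinearMap.ker (S - 1) ⊓ ysub k ζ T m

theorem mem_fix (S : Module.End A M) (x : M) : x ∈ LinearMap.ker (S - 1) ↔ S x = x := by
  rw [LinearMap.mem_ker, LinearMap.sub_apply, sub_eq_zero, Module.End.one_apply]

theorem mem_ysub (ζ : k) (T : Module.End A M) (m : ℕ) (x : M) :
    x ∈ ysub k ζ T m ↔ T x = ζ ^ m • x := by
  rw [ysub, LinearMap.mem_ker, LinearMap.sub_apply, sub_eq_zero, LinearMap.smul_apply,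
    Module.End.one_apply]

theorem pow_apply_ysub (ζ : k) (T : Module.End A M) (m : ℕ) (x : M) (hx : T x = ζ ^ m • x)
    (j : ℕ) : (T ^ j) x = (ζ ^ m) ^ j • x := by
  induction j with
  | zero => simp
  | succ j ih =>
    rw [pow_succ, Module.End.mul_apply, hx, LinearMap.map_smul_of_tower, ih, smul_smul, ← pow_succ']

theorem eop_apply (ζ : k) (T : Module.End A M) (l m : ℕ) (x : M)
    (hx : T x = ζ ^ m • x) : eop p k ζ T l x =
      (((p - 1 : ℕ) : k)⁻¹ * ∑ j ∈ Finset.range (p - 1), ((ζ ^ l)⁻¹ * ζ ^ m) ^ j) • x := by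
  rw [eop, LinearMap.smul_apply, LinearMap.sum_apply, mul_smul, Finset.sum_smul]
  congr 1
  refine Finset.sum_congr rfl fun j _ => ?_
  rw [LinearMap.smul_apply, pow_apply_ysub k ζ T m x hx, smul_smul, mul_pow]

theorem eop_apply_self (ζ : k) (hζ : ζ ≠ 0) (T : Module.End A M) (m : ℕ) (x : M)
    (hx : T x = ζ ^ m • x) : eop p k ζ T m x = x := by
  rw [eop_apply p k ζ T m m x hx, inv_mul_cancel₀ (pow_ne_zero _ hζ)]
  simp only [one_pow, Finset.sum_const, Finset.card_range, nsmul_eq_mul, mul_one]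
  rw [inv_mul_cancel₀ (pm1_ne p k), one_smul]

theorem eop_apply_ne (ζ : k) (hζ : IsPrimitiveRoot ζ (p - 1)) (T : Module.End A M) (l m : ℕ)
    (hl : l < p - 1) (hm : m < p - 1) (hlm : l ≠ m) (x : M)
    (hx : T x = ζ ^ m • x) : eop p k ζ T l x = 0 := by
  have hζ0 : ζ ≠ 0 := hζ.ne_zero (by omega)
  rw [eop_apply p k ζ T l m x hx, geom_zero, mul_zero, zero_smul]
  · intro h
    rw [inv_mul_eq_one₀ (pow_ne_zero _ hζ0)] at h
    exact hlm (hζ.pow_inj hl hm h)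
  · rw [mul_pow, inv_pow, ← pow_mul, ← pow_mul, mul_comm l, mul_comm m, pow_mul, pow_mul,
      hζ.pow_eq_one, one_pow, one_pow, inv_one, mul_one]

theorem eop_mem (ζ : k) (hζ : ζ ≠ 0) (hζ1 : ζ ^ (p - 1) = 1) (T : Module.End A M)
    (hT : T ^ (p - 1) = 1) (m : ℕ) (x : M) :
    T (eop p k ζ T m x) = ζ ^ m • eop p k ζ T m x := by
  rw [← Module.End.mul_apply, mul_eop p k ζ hζ hζ1 T hT, LinearMap.smul_apply]

theorem ysub_proj [Module.Projective A M] (ζ : k) (hζ : ζ ≠ 0) (hζ1 : ζ ^ (p - 1) = 1)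
    (T : Module.End A M) (hT : T ^ (p - 1) = 1) (m : ℕ) : Module.Projective A (ysub k ζ T m) := by
  refine Module.Projective.of_split (ysub k ζ T m).subtype
    (LinearMap.codRestrict _ (eop p k ζ T m) (fun x => (mem_ysub k ζ T m _).2
      (eop_mem p k ζ hζ hζ1 T hT m x))) ?_
  ext x
  exact eop_apply_self p k ζ hζ T m x ((mem_ysub k ζ T m _).1 x.2)

theorem pow_fix (S : Module.End A M) (x : M) (hx : S x = x) (j : ℕ) : (S ^ j) x = x := by
  induction j with
  | zero => simp
  | succ j ih => rw [pow_succ, Module.End.mul_apply, hx, ih]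

theorem omega_step [IsArtinianRing A] (hA : ProjSubSplit A) [Module.Projective A M]
    [Module.Finite A M] (hodd : Odd p)
    (ζ : k) (hζ : IsPrimitiveRoot ζ (p - 1)) (S T : Module.End A M) (hS : S ^ p = 1)
    (hT : T ^ (p - 1) = 1) (a : (ZMod p)ˣ) (ha : ZMod.castHom (dvd_refl p) k (a : ZMod p) = ζ)
    (hST : S * T = T * S ^ (a : ZMod p).val)
    (h1 : ∀ y, S y = y → ∃ z, nop p S z = y) (h2 : ∀ x, nop p S x = 0 → ∃ z, x = (S - 1) z)
    (m : ℕ) (K P1 : ModuleCat.{0} A) [Module.Projective A P1]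
    (e : xsub k ζ S T m ≃ₗ[A] (K × P1)) :
    ∃ K1 K' P' : ModuleCat.{0} A, isSyzygy K K1 ∧ isSyzygy K1 K' ∧ noProjSummand K' ∧
      Module.Projective A P' ∧ Nonempty (xsub k ζ S T (m + 1) ≃ₗ[A] (K' × P')) := by
  have hpos : 0 < p - 1 := by have := hp.out.two_le; omega
  have hζ0 : ζ ≠ 0 := hζ.ne_zero (by omega)
  have hU := uop_conj p k S T hS a hST
  rw [ha] at hU
  have hN := nop_conj p S T hS a hST
  have hEU := eop_uop p k ζ hζ0 (uop p k S) T hU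
  have hEN := eop_nop p k ζ S T hN
  obtain ⟨W, W', hW1, hW2, hW3⟩ := uop_factor p k hodd S hS
  have hNU := nop_mul_uop p k hodd S hS
  have hSN : (S - 1) * nop p S = 0 := by rw [nop, mul_geom_sum, hS, sub_self]
  have hY0 := ysub_proj p k ζ hζ0 hζ.pow_eq_one T hT m
  have hY1 := ysub_proj p k ζ hζ0 hζ.pow_eq_one T hT (m + 1)
  -- the first map
  let π1 : ysub k ζ T m →ₗ[A] xsub k ζ S T m :=
    LinearMap.codRestrict _ ((nop p S).comp (ysub k ζ T m).subtype) (by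
      intro x
      refine ⟨?_, ?_⟩
      · exact LinearMap.congr_fun hSN (x : M)
      · refine (mem_ysub k ζ T m _).2 ?_
        have hx := (mem_ysub k ζ T m _).1 x.2
        change T (nop p S (x : M)) = ζ ^ m • nop p S (x : M)
        rw [← Module.End.mul_apply, ← hN, Module.End.mul_apply, hx,
          LinearMap.map_smul_of_tower])
  have hπ1 : Function.Surjective π1 := by
    rintro ⟨y, hy⟩
    obtain ⟨hy1, hy2⟩ := hy
    obtain ⟨z, hz⟩ := h1 y ((mem_fix S y).1 hy1)
    refine ⟨⟨eop p k ζ T m z, (mem_ysub k ζ T m _).2 (eop_mem p k ζ hζ0 hζ.pow_eq_one T hT m z)⟩,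
      Subtype.ext ?_⟩
    change nop p S (eop p k ζ T m z) = y
    rw [← Module.End.mul_apply, ← hEN, Module.End.mul_apply, hz]
    exact eop_apply_self p k ζ hζ0 T m y ((mem_ysub k ζ T m _).1 hy2)
  have hfin0 : Module.Finite A (ysub k ζ T m) := inferInstance
  obtain ⟨K1, P2, hK1, -, hP2, ⟨e1⟩⟩ := kernel_step hA e π1 hπ1
  let π2 : ysub k ζ T (m + 1) →ₗ[A] LinearMap.ker π1 :=
    LinearMap.codRestrict _ (LinearMap.codRestrict (ysub k ζ T m)
        ((uop p k S).comp (ysub k ζ T (m + 1)).subtype) (by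
      intro x
      have hx := (mem_ysub k ζ T (m + 1) _).1 x.2
      rw [mem_ysub]
      change T (uop p k S (x : M)) = ζ ^ m • uop p k S (x : M)
      have h3 : ζ • (T * uop p k S) (x : M) = ζ • ζ ^ m • uop p k S (x : M) := by
        rw [← LinearMap.smul_apply, ← hU, Module.End.mul_apply, hx, LinearMap.map_smul_of_tower,
          smul_smul, pow_succ']
      exact smul_right_injective M hζ0 h3)) (by
      intro x
      rw [LinearMap.mem_ker]
      apply Subtype.ext
      exact LinearMap.congr_fun hNU (x : M))
  have hπ2 : Function.Surjective π2 := by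
    rintro ⟨⟨x, hx⟩, hx2⟩
    have hx3 : nop p S x = 0 := congrArg Subtype.val hx2
    obtain ⟨z, hz⟩ := h2 x hx3
    rw [← hW2] at hz
    refine ⟨⟨eop p k ζ T (m + 1) (W' z), (mem_ysub k ζ T _ _).2
      (eop_mem p k ζ hζ0 hζ.pow_eq_one T hT _ _)⟩, Subtype.ext (Subtype.ext ?_)⟩
    change uop p k S (eop p k ζ T (m + 1) (W' z)) = x
    rw [← Module.End.mul_apply, ← hEU, Module.End.mul_apply, ← Module.End.mul_apply (uop p k S), ← hz]
    exact eop_apply_self p k ζ hζ0 T m x ((mem_ysub k ζ T m _).1 hx)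
  obtain ⟨K', P', hK', hno, hP', ⟨e2⟩⟩ := kernel_step hA e1 π2 hπ2
  -- identify the kernel
  let d : xsub k ζ S T (m + 1) →ₗ[A] LinearMap.ker π2 :=
    LinearMap.codRestrict _ (Submodule.inclusion inf_le_right) (by
      rintro ⟨x, hx1, hx2⟩
      rw [LinearMap.mem_ker]
      apply Subtype.ext
      apply Subtype.ext
      change uop p k S x = 0
      replace hx1 : (S - 1) x = 0 := hx1
      rw [hW1, Module.End.mul_apply, hx1, map_zero])
  have hd : Function.Bijective d := by
    constructor
    · intro x y hxy
      apply Subtype.ext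
      exact congrArg (fun z : LinearMap.ker π2 => ((z : ysub k ζ T (m + 1)) : M)) hxy
    · rintro ⟨⟨x, hx⟩, hx2⟩
      have hx3 : uop p k S x = 0 :=
        congrArg (fun z : LinearMap.ker π1 => ((z : ysub k ζ T m) : M)) hx2
      refine ⟨⟨x, ?_, hx⟩, rfl⟩
      change (S - 1) x = 0
      rw [← hW3, Module.End.mul_apply, hx3, map_zero]
  exact ⟨K1, K', P', hK1, hK', hno, hP', ⟨(LinearEquiv.ofBijective d hd).trans e2⟩⟩

theorem fix_decomp (ζ : k) (hζ : IsPrimitiveRoot ζ (p - 1)) (S T : Module.End A M)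
    (hT : T ^ (p - 1) = 1) (a : ℕ) (hST : S * T = T * S ^ a) :
    Nonempty (LinearMap.ker (S - 1) ≃ₗ[A] (∀ m : Fin (p - 1), xsub k ζ S T m)) := by
  have hpos : 0 < p - 1 := by have := hp.out.two_le; omega
  have hζ0 : ζ ≠ 0 := hζ.ne_zero (by omega)
  have hTS : ∀ x, S x = x → ∀ j, S ((T ^ j) x) = (T ^ j) x := by
    intro x hx j
    induction j with
    | zero => simpa using hx
    | succ j ih =>
      rw [pow_succ', Module.End.mul_apply, ← Module.End.mul_apply S T, hST, Module.End.mul_apply,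
        pow_fix S _ ih]
  have hES : ∀ x, S x = x → ∀ m, S (eop p k ζ T m x) = eop p k ζ T m x := by
    intro x hx m
    rw [eop, LinearMap.smul_apply, LinearMap.map_smul_of_tower, LinearMap.sum_apply, map_sum]
    congr 1
    refine Finset.sum_congr rfl fun j _ => ?_
    rw [LinearMap.smul_apply, LinearMap.map_smul_of_tower, hTS x hx]
  let f : LinearMap.ker (S - 1) →ₗ[A] (∀ m : Fin (p - 1), xsub k ζ S T m) :=
    LinearMap.pi fun m => LinearMap.codRestrict _
      ((eop p k ζ T m).comp (LinearMap.ker (S - 1)).subtype) (fun x =>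
        ⟨(mem_fix S _).2 (hES _ ((mem_fix S _).1 x.2) m),
          (mem_ysub k ζ T m _).2 (eop_mem p k ζ hζ0 hζ.pow_eq_one T hT m _)⟩)
  refine ⟨LinearEquiv.ofBijective f ⟨?_, ?_⟩⟩
  · rw [← LinearMap.ker_eq_bot, LinearMap.ker_eq_bot']
    intro x hx
    apply Subtype.ext
    have h0 := LinearMap.congr_fun (sum_eop p k ζ hζ T) (x : M)
    have h1 : ((1 : Module.End A M) (x : M)) = 0 := by
      rw [← h0, LinearMap.sum_apply]
      refine Finset.sum_eq_zero fun m hm => ?_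
      exact congrArg Subtype.val (congrFun hx ⟨m, Finset.mem_range.1 hm⟩)
    exact h1
  · intro y
    refine ⟨⟨∑ m, (y m : M), Submodule.sum_mem _ fun m _ => (y m).2.1⟩, ?_⟩
    ext l
    change eop p k ζ T l (∑ m, (y m : M)) = y l
    rw [map_sum, Finset.sum_eq_single l]
    · exact eop_apply_self p k ζ hζ0 T l _ ((mem_ysub k ζ T l _).1 (y l).2.2)
    · intro b _ hb
      exact eop_apply_ne p k ζ hζ T l b l.2 b.2 (fun h => hb (Fin.ext h.symm)) _
        ((mem_ysub k ζ T b _).1 (y b).2.2)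
    · simp

theorem main_abstract [IsArtinianRing A] (hA : ProjSubSplit A) [Module.Projective A M]
    [Module.Finite A M] (hodd : Odd p)
    (ζ : k) (hζ : IsPrimitiveRoot ζ (p - 1)) (S T : Module.End A M) (hS : S ^ p = 1)
    (hT : T ^ (p - 1) = 1) (a : (ZMod p)ˣ) (ha : ZMod.castHom (dvd_refl p) k (a : ZMod p) = ζ)
    (hST : S * T = T * S ^ (a : ZMod p).val)
    (h1 : ∀ y, S y = y → ∃ z, nop p S z = y) (h2 : ∀ x, nop p S x = 0 → ∃ z, x = (S - 1) z)
    (K0 P0 : ModuleCat.{0} A) (hP0 : Module.Projective A P0) (hK0 : noProjSummand K0)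
    (e0 : xsub k ζ S T 0 ≃ₗ[A] (K0 × P0)) :
    ∃ (K : Fin (p - 1) → ModuleCat.{0} A) (P : ModuleCat.{0} A), Module.Projective A P ∧
      (∀ m : Fin (p - 1), isOmegaPow (2 * (m : ℕ)) K0 (K m)) ∧
      Nonempty (LinearMap.ker (S - 1) ≃ₗ[A] ((∀ m : Fin (p - 1), ↥(K m)) × ↥P)) := by
  have key : ∀ m : ℕ, ∃ K P : ModuleCat.{0} A, syzChain (2 * m) K0 K ∧ noProjSummand K ∧
      Module.Projective A P ∧ Nonempty (xsub k ζ S T m ≃ₗ[A] (K × P)) := by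
    intro m
    induction m with
    | zero => exact ⟨K0, P0, rfl, hK0, hP0, ⟨e0⟩⟩
    | succ m ih =>
      obtain ⟨K, P, hc, -, hP, ⟨e⟩⟩ := ih
      obtain ⟨K1, K', P', hK1, hK', hno, hP', he⟩ :=
        omega_step p k hA hodd ζ hζ S T hS hT a ha hST h1 h2 m K P e
      exact ⟨K', P', syzChain_snoc _ _ _ _ (syzChain_snoc _ _ _ _ hc hK1) hK', hno, hP', he⟩
  choose K P hc hno hP he using key
  obtain ⟨d⟩ := fix_decomp p k ζ hζ S T hT _ hST
  refine ⟨fun m => K m, ModuleCat.of A (∀ m : Fin (p - 1), P m), ?_,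
    fun m => syzChain_omega _ _ _ (hc m) (hno m), ?_⟩
  · have : ∀ m : Fin (p - 1), Module.Projective A (P m) := fun m => hP m
    exact Module.Projective.of_equiv (DFinsupp.linearEquivFunOnFintype (R := A)
      (M := fun m : Fin (p - 1) => P m))
  · let E : ∀ m : Fin (p - 1), xsub k ζ S T m ≃ₗ[A] (K m × P m) := fun m => (he m).some
    let f : (∀ m : Fin (p - 1), (K m × P m)) ≃ₗ[A]
        ((∀ m : Fin (p - 1), K m) × (∀ m : Fin (p - 1), P m)) :=
      { toFun := fun x => (fun m => (x m).1, fun m => (x m).2)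
        invFun := fun x m => (x.1 m, x.2 m)
        map_add' := fun _ _ => rfl
        map_smul' := fun _ _ => rfl
        left_inv := fun _ => rfl
        right_inv := fun _ => rfl }
    exact ⟨(d.trans (LinearEquiv.piCongrRight E)).trans f⟩

end OperatorModules

section GroupFacts

theorem orbit_sum {Ω : Type} [Fintype Ω] (p : ℕ) (hp : p.Prime) (c : Equiv.Perm Ω)
    (hc : c ^ p = 1) :
    ∃ t : Ω → ℕ, (∀ x, c x = x → t x = 0) ∧
      ∀ x, c x ≠ x → ∑ i ∈ Finset.range p, t ((c ^ i) x) = 1 := by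
  classical
  let s := Equiv.Perm.SameCycle.setoid c
  let r : Ω → Ω := fun x => (Quotient.mk s x).out
  have hr : ∀ x, c.SameCycle (r x) x := fun x => Quotient.mk_out (s := s) x
  have hr2 : ∀ x y, c.SameCycle x y → r x = r y := fun x y h =>
    congrArg Quotient.out (Quotient.sound (s := s) h)
  refine ⟨fun x => if r x = x ∧ c x ≠ x then 1 else 0, ?_, ?_⟩
  · intro x hx; simp [hx]
  · intro x hx
    have hfree : ∀ i, (c ^ i) x = x → p ∣ i := by
      intro i hi
      by_contra hnd
      apply hx
      have hcop : Nat.Coprime i p := ((Nat.Prime.coprime_iff_not_dvd hp).2 hnd).symm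
      have : ∃ j, i * j ≡ 1 [MOD p] := by
        obtain ⟨j, -, hj⟩ := Nat.exists_mul_mod_eq_one_of_coprime hcop hp.one_lt
        exact ⟨j, by rw [Nat.ModEq, hj, Nat.mod_eq_of_lt hp.one_lt]⟩
      obtain ⟨j, hj⟩ := this
      have h1 : c ^ (i * j) = c := by
        rw [pow_eq_pow_mod _ hc, hj, Nat.mod_eq_of_lt hp.one_lt, pow_one]
      have h2 : (c ^ (i * j)) x = x := by
        rw [pow_mul]
        exact Equiv.Perm.pow_apply_eq_self_of_apply_eq_self hi j
      rw [h1] at h2; exact h2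
    have hne : ∀ i, c ((c ^ i) x) ≠ (c ^ i) x := by
      intro i h
      apply hx
      have : (c ^ i) (c x) = (c ^ i) x := by
        rw [← Equiv.Perm.mul_apply, ← pow_succ, pow_succ', Equiv.Perm.mul_apply, h]
      exact (c ^ i).injective this
    have hsame : ∀ i, r ((c ^ i) x) = r x := by
      intro i
      refine hr2 _ _ ?_
      exact Equiv.Perm.SameCycle.symm ⟨i, by simp⟩
    obtain ⟨i0, hi0⟩ := (hr x).symm
    -- natural exponent
    have : ∃ i < p, (c ^ i) x = r x := by
      refine ⟨(i0 % (p : ℤ)).toNat, ?_, ?_⟩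
      · have h1 := Int.emod_lt_of_pos i0 (by exact_mod_cast hp.pos : (0:ℤ) < p)
        have h2 := Int.emod_nonneg i0 (by exact_mod_cast hp.ne_zero : (p:ℤ) ≠ 0)
        omega
      · have h2 := Int.emod_nonneg i0 (by exact_mod_cast hp.ne_zero : (p:ℤ) ≠ 0)
        rw [← hi0, ← zpow_natCast, Int.toNat_of_nonneg h2]
        conv_rhs => rw [← Int.emod_add_mul_ediv i0 p, zpow_add, zpow_mul, zpow_natCast, hc]
        simp
    obtain ⟨i, hi, hir⟩ := this
    rw [Finset.sum_eq_single i]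
    · simp only []
      rw [if_pos ⟨by rw [hsame, hir], hne i⟩]
    · intro j hj hji
      simp only []
      rw [if_neg]
      rintro ⟨h1, -⟩
      rw [hsame, ← hir] at h1
      apply hji
      have hj' := Finset.mem_range.1 hj
      rcases le_total i j with hle | hle
      · have h3 : (c ^ i) ((c ^ (j - i)) x) = (c ^ i) x := by
          rw [← Equiv.Perm.mul_apply, ← pow_add, Nat.add_sub_cancel' hle, h1]
        have := Nat.eq_zero_of_dvd_of_lt (hfree _ ((c ^ i).injective h3)) (by omega)
        omega
      · have h3 : (c ^ j) ((c ^ (i - j)) x) = (c ^ j) x := by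
          rw [← Equiv.Perm.mul_apply, ← pow_add, Nat.add_sub_cancel' hle, h1]
        have := Nat.eq_zero_of_dvd_of_lt (hfree _ ((c ^ j).injective h3)) (by omega)
        omega
    · intro h; exact absurd (Finset.mem_range.2 hi) h

theorem card_quot {Ω : Type} [Fintype Ω] (p : ℕ) (hp : p.Prime) (c : Equiv.Perm Ω)
    (hc : c ^ p = 1) (x0 : Ω) (h0 : c x0 = x0) (hfix : ∀ x, c x = x → x = x0) :
    ∃ d, Fintype.card Ω = 1 + p * d := by
  classical
  obtain ⟨t, ht0, ht1⟩ := orbit_sum p hp c hc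
  refine ⟨∑ x, t x, ?_⟩
  have h1 : ∑ x, ∑ i ∈ Finset.range p, t ((c ^ i) x) = p * ∑ x, t x := by
    rw [Finset.sum_comm, Finset.sum_congr rfl (fun i _ => Equiv.sum_comp (c ^ i) t)]
    simp
  rw [← h1]
  have h2 : ∀ x, ∑ i ∈ Finset.range p, t ((c ^ i) x) = if x = x0 then 0 else 1 := by
    intro x
    split_ifs with h
    · subst h
      refine Finset.sum_eq_zero fun i _ => ?_
      rw [Equiv.Perm.pow_apply_eq_self_of_apply_eq_self h0, ht0 _ h0]
    · exact ht1 x (fun hx => h (hfix x hx))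
  simp_rw [h2]
  rw [← Finset.card_univ, Finset.card_eq_sum_ones, ← Finset.add_sum_erase _ _ (Finset.mem_univ x0)]
  congr 1
  rw [← Finset.add_sum_erase Finset.univ (fun x => if x = x0 then 0 else 1) (Finset.mem_univ x0),
    if_pos rfl, zero_add]
  refine Finset.sum_congr rfl fun x hx => ?_
  rw [if_neg (Finset.ne_of_mem_erase hx)]

theorem stab_sum {G : Type} [Group G] [Fintype G] (p : ℕ) (hp : p.Prime) (N : Subgroup G)
    [Fintype N] [Fintype (G ⧸ N)]
    (σ : G) (hσN : σ ∈ N) (hσp : σ ^ p = 1) (hσ1 : σ ≠ 1) (hpp : ¬ p ^ 2 ∣ Fintype.card G)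
    (hfix : ∀ q : G ⧸ N, σ • q = q → q = QuotientGroup.mk 1) :
    ∃ (t : G ⧸ N → ℕ) (κ : ℕ), ¬ p ∣ κ ∧ t (QuotientGroup.mk 1) = 0 ∧ ∀ q : G ⧸ N, q ≠ QuotientGroup.mk 1 →
      ∑ n : N, t ((n : G) • q) = κ := by
  classical
  let c : Equiv.Perm (G ⧸ N) := MulAction.toPerm σ
  have hci : ∀ i x, (c ^ i) x = σ ^ i • x := by
    intro i x
    induction i with
    | zero => simp
    | succ i ih => rw [pow_succ', Equiv.Perm.mul_apply, ih, pow_succ', mul_smul]; rfl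
  have hc : c ^ p = 1 := by ext x; rw [hci, hσp]; simp
  let σ' : N := ⟨σ, hσN⟩
  let b : Equiv.Perm N := Equiv.mulLeft σ'
  have hbi : ∀ i x, (b ^ i) x = σ' ^ i * x := by
    intro i x
    rw [Equiv.pow_mulLeft]; rfl
  have hσ'p : σ' ^ p = 1 := Subtype.ext hσp
  have hb : b ^ p = 1 := by ext x; rw [hbi, hσ'p]; simp
  obtain ⟨t, ht0, ht1⟩ := orbit_sum p hp c hc
  obtain ⟨u, -, hu1⟩ := orbit_sum p hp b hb
  have hu : ∀ n, ∑ i ∈ Finset.range p, u (σ' ^ i * n) = 1 := by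
    intro n
    rw [← hu1 n]
    · exact Finset.sum_congr rfl fun i _ => by rw [hbi]
    · intro h
      have : σ' * n = n := h
      rw [mul_eq_right] at this
      exact hσ1 (congrArg Subtype.val this)
  refine ⟨t, ∑ n, u n, ?_, ?_, ?_⟩
  · intro ⟨d, hd⟩
    have h1 : ∑ n : N, ∑ i ∈ Finset.range p, u (σ' ^ i * n) = p * ∑ n, u n := by
      have h5 : ∀ i, ∑ x, u (σ' ^ i * x) = ∑ x, u x := fun i =>
        Equiv.sum_comp (Equiv.mulLeft (σ' ^ i)) u
      rw [Finset.sum_comm, Finset.sum_congr rfl (fun i _ => h5 i)]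
      simp
    simp_rw [hu] at h1
    rw [Finset.sum_const, Finset.card_univ, smul_eq_mul, mul_one, hd] at h1
    apply hpp
    have h2 : Nat.card N ∣ Nat.card G := Subgroup.card_subgroup_dvd_card N
    rw [Nat.card_eq_fintype_card, Nat.card_eq_fintype_card, h1] at h2
    refine dvd_trans ?_ h2
    exact ⟨d, by ring⟩
  · apply ht0
    change σ • (QuotientGroup.mk 1 : G ⧸ N) = _
    rw [MulAction.Quotient.smul_mk, QuotientGroup.eq]
    simpa using hσN
  · intro q hq
    have hnq : ∀ n : N, (n : G) • q ≠ QuotientGroup.mk 1 := by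
      intro n h
      apply hq
      have : q = (n : G)⁻¹ • (QuotientGroup.mk 1 : G ⧸ N) := by rw [← h, inv_smul_smul]
      rw [this, MulAction.Quotient.smul_mk, QuotientGroup.eq]
      simp
    calc ∑ n : N, t ((n : G) • q)
        = ∑ n : N, ∑ i ∈ Finset.range p, u (σ' ^ i * n) * t ((n : G) • q) := by
          refine Finset.sum_congr rfl fun n _ => ?_
          rw [← Finset.sum_mul, hu, one_mul]
      _ = ∑ i ∈ Finset.range p, ∑ n : N, u (σ' ^ i * n) * t ((n : G) • q) := Finset.sum_comm
      _ = ∑ i ∈ Finset.range p, ∑ n : N, u n * t ((σ⁻¹ ^ i * (n : G)) • q) := by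
          refine Finset.sum_congr rfl fun i _ => ?_
          refine Fintype.sum_equiv (Equiv.mulLeft (σ' ^ i)) _ _ fun n => ?_
          simp [σ']
      _ = ∑ n : N, u n * ∑ i ∈ Finset.range p, t ((σ⁻¹ ^ i * (n : G)) • q) := by
          rw [Finset.sum_comm]
          exact Finset.sum_congr rfl fun n _ => (Finset.mul_sum _ _ _).symm
      _ = ∑ n : N, u n := by
          refine Finset.sum_congr rfl fun n _ => ?_
          have h1 : ∑ i ∈ Finset.range p, t ((σ⁻¹ ^ i * (n : G)) • q) =
              ∑ i ∈ Finset.range p, t ((c ^ i) (σ • (n : G) • q)) := by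
            rw [← Finset.sum_range_reflect]
            refine Finset.sum_congr rfl fun i hi => ?_
            have hi' := Finset.mem_range.1 hi
            rw [hci, smul_smul, smul_smul]
            congr 3
            have h5 : σ ^ (p - 1 - i) * (σ ^ i * σ) = 1 := by
              rw [← pow_succ, ← pow_add, ← hσp]; congr 1; omega
            rw [inv_pow, ← eq_inv_of_mul_eq_one_right h5]
          rw [h1, ht1, mul_one]
          intro h
          have h3 : σ • σ • (n : G) • q = σ • (n : G) • q := h
          have h4 := hfix _ h3
          refine hnq (σ' * n) ?_
          rw [← h4, smul_smul]; rfl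

end GroupFacts

section RegularModule

open MonoidAlgebra

variable {k G : Type} [Field k] [Group G]

/-- Right multiplication by a group element, an endomorphism of the regular module. -/
noncomputable def rmul (k : Type) {G : Type} [Field k] [Group G] (g : G) :
    Module.End (MonoidAlgebra k G) (MonoidAlgebra k G) :=
  LinearMap.toSpanSingleton _ _ (single g (1 : k))

theorem rmul_apply (g : G) (x : MonoidAlgebra k G) : rmul k g x = x * single g (1 : k) := rfl

theorem rmul_coeff (g : G) (x : MonoidAlgebra k G) (h : G) :
    (rmul k g x).coeff h = x.coeff (h * g⁻¹) := by
  rw [rmul_apply]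
  have := coeff_mul_single_mul x (1 : k) (h * g⁻¹) g
  simpa using this

theorem rmul_mul (g h : G) : rmul k (g * h) = rmul k h * rmul k g := by
  ext1
  simp [rmul_apply, Module.End.mul_apply, single_mul_single]

theorem rmul_one : rmul k (1 : G) = 1 := by
  refine LinearMap.ext fun x => ?_
  rw [rmul_apply, ← MonoidAlgebra.one_def, mul_one]; rfl

theorem rmul_pow (g : G) (n : ℕ) : rmul k g ^ n = rmul k (g ^ n) := by
  induction n with
  | zero => rw [pow_zero, pow_zero, rmul_one]
  | succ n ih => rw [pow_succ, ih, pow_succ', rmul_mul]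

/-- Pointwise multiplication by a function. -/
noncomputable def pmul (t : G → ℕ) [Fintype G] (x : MonoidAlgebra k G) : MonoidAlgebra k G :=
  MonoidAlgebra.ofCoeff (Finsupp.equivFunOnFinite.symm fun g => (t g : k) * x.coeff g)

theorem pmul_coeff (t : G → ℕ) [Fintype G] (x : MonoidAlgebra k G) (g : G) :
    (pmul t x).coeff g = (t g : k) * x.coeff g := rfl

theorem reg_sum_aux [Fintype G] (p : ℕ) (hp : p.Prime) (σ : G) (hσ : σ ^ p = 1) (h1 : σ ≠ 1) :
    ∃ t : G → ℕ, ∀ g, ∑ i ∈ Finset.range p, t (g * σ ^ i) = 1 := by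
  have h2 : ∀ i g, ((Equiv.mulRight σ) ^ i) g = g * σ ^ i := by
    intro i g
    rw [Equiv.pow_mulRight]; rfl
  obtain ⟨t, -, ht⟩ := orbit_sum p hp (Equiv.mulRight σ) (by ext g; rw [h2, hσ]; simp)
  refine ⟨t, fun g => ?_⟩
  rw [← ht g]
  · exact Finset.sum_congr rfl fun i _ => by rw [h2]
  · intro h
    exact h1 (mul_eq_left.1 h)

theorem nop_apply (p : ℕ) (σ : G) (x : MonoidAlgebra k G) :
    nop p (rmul k σ) x = ∑ i ∈ Finset.range p, rmul k (σ ^ i) x := by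
  simp only [nop, LinearMap.sum_apply, rmul_pow]

theorem reg_h1 [Fintype G] (p : ℕ) (hp : p.Prime) (σ : G) (hσ : σ ^ p = 1) (h1 : σ ≠ 1)
    (y : MonoidAlgebra k G) (hy : rmul k σ y = y) : ∃ z, nop p (rmul k σ) z = y := by
  obtain ⟨t, ht⟩ := reg_sum_aux p hp σ⁻¹ (by simp [hσ]) (by simpa using h1)
  refine ⟨pmul t y, ?_⟩
  rw [nop_apply]
  ext g
  rw [coeff_sum, Finsupp.finsetSum_apply]
  have h2 : ∀ i, y.coeff (g * σ⁻¹ ^ i) = y.coeff g := by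
    intro i
    rw [inv_pow, ← rmul_coeff, ← rmul_pow, pow_fix _ _ hy]
  have h3 : ∀ i, (rmul k (σ ^ i) (pmul t y)).coeff g = (t (g * σ⁻¹ ^ i) : k) * y.coeff g := by
    intro i
    rw [rmul_coeff, pmul_coeff, ← inv_pow, h2]
  simp_rw [h3]
  rw [← Finset.sum_mul, ← Nat.cast_sum, ht, Nat.cast_one, one_mul]

theorem reg_h2 [Fintype G] (p : ℕ) (hp : p.Prime) (σ : G) (hσ : σ ^ p = 1) (h1 : σ ≠ 1)
    (x : MonoidAlgebra k G) (hx : nop p (rmul k σ) x = 0) : ∃ z, x = (rmul k σ - 1) z := by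
  obtain ⟨t, ht⟩ := reg_sum_aux p hp σ hσ h1
  have e1 : x = ∑ i ∈ Finset.range p, rmul k (σ⁻¹ ^ i) (pmul t (rmul k (σ ^ i) x)) := by
    ext g
    rw [coeff_sum, Finsupp.finsetSum_apply]
    have h3 : ∀ i, (rmul k (σ⁻¹ ^ i) (pmul t (rmul k (σ ^ i) x))).coeff g
        = (t (g * σ ^ i) : k) * x.coeff g := by
      intro i
      rw [rmul_coeff, pmul_coeff, rmul_coeff]; simp
    simp_rw [h3]
    rw [← Finset.sum_mul, ← Nat.cast_sum, ht, Nat.cast_one, one_mul]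
  have e2 : ∑ i ∈ Finset.range p, pmul t (rmul k (σ ^ i) x) = 0 := by
    ext g
    rw [nop_apply] at hx
    have := congrArg (fun y : MonoidAlgebra k G => y.coeff g) hx
    simp only [coeff_sum, Finsupp.finsetSum_apply] at this ⊢
    simp_rw [pmul_coeff]
    rw [← Finset.mul_sum, this]; simp
  have e3 : ∀ i, ∃ W : Module.End (MonoidAlgebra k G) (MonoidAlgebra k G),
      rmul k (σ⁻¹ ^ i) = 1 + (rmul k σ - 1) * W := by
    intro i
    have : σ⁻¹ ^ i = σ ^ ((p - 1) * i) := by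
      rw [pow_mul]
      congr 1
      rw [inv_eq_iff_mul_eq_one, ← pow_succ', Nat.sub_add_cancel hp.one_le, hσ]
    rw [this, ← rmul_pow]
    exact ⟨_, by rw [mul_geom_sum]; abel⟩
  choose W hW using e3
  refine ⟨∑ i ∈ Finset.range p, W i (pmul t (rmul k (σ ^ i) x)), ?_⟩
  conv_lhs => rw [e1]
  simp_rw [hW]
  simp only [LinearMap.add_apply, Module.End.one_apply, Finset.sum_add_distrib, e2, zero_add,
    Module.End.mul_apply]
  rw [map_sum]

theorem perm_coeff (N : Subgroup G)
    (x : (Representation.ofMulAction k G (G ⧸ N)).asModule) (g : G) (q : G ⧸ N) :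
    ((Representation.ofMulAction k G (G ⧸ N)).asModuleEquiv (single g (1 : k) • x)).coeff q
      = ((Representation.ofMulAction k G (G ⧸ N)).asModuleEquiv x).coeff (g⁻¹ • q) := by
  rw [Representation.asModuleEquiv_map_smul, Representation.asAlgebraHom_single, one_smul,
    Representation.coeff_ofMulAction]

theorem inv_equiv [Finite G] (N : Subgroup G) (X0 : Submodule (MonoidAlgebra k G) (MonoidAlgebra k G))
    (h : ∀ x, x ∈ X0 ↔ ∀ g, ∀ n ∈ N, x.coeff (g * n) = x.coeff g) :
    Nonempty ((Representation.ofMulAction k G (G ⧸ N)).asModule ≃ₗ[MonoidAlgebra k G] X0) := by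
  classical
  have := Fintype.ofFinite G
  have := Fintype.ofFinite (G ⧸ N)
  let E := (Representation.ofMulAction k G (G ⧸ N)).asModuleEquiv
  let φ0 : (Representation.ofMulAction k G (G ⧸ N)).asModule →ₗ[k] MonoidAlgebra k G :=
    { toFun := fun x => MonoidAlgebra.ofCoeff (Finsupp.equivFunOnFinite.symm
        fun g => (E x).coeff (QuotientGroup.mk g))
      map_add' := by
        intro x y; ext g; simp
      map_smul' := by
        intro c x; ext g; simp }
  have hφ0 : ∀ x g, (φ0 x).coeff g = (E x).coeff (QuotientGroup.mk g) := fun x g => rfl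
  let φ := MonoidAlgebra.equivariantOfLinearOfComm φ0 (by
    intro g x
    ext h
    rw [hφ0, perm_coeff, smul_eq_mul]
    have := coeff_single_mul_mul (φ0 x) (1 : k) g (g⁻¹ * h)
    rw [mul_inv_cancel_left, one_mul] at this
    rw [this]; rfl)
  have hφ : ∀ x g, (φ x).coeff g = (E x).coeff (QuotientGroup.mk g) := fun x g => rfl
  have hmem : ∀ x, φ x ∈ X0 := by
    intro x
    rw [h]
    intro g n hn
    rw [hφ, hφ]
    congr 1
    rw [QuotientGroup.eq]
    simpa using hn
  refine ⟨LinearEquiv.ofBijective (φ.codRestrict X0 hmem) ⟨?_, ?_⟩⟩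
  · intro x y hxy
    have h1 : φ x = φ y := congrArg Subtype.val hxy
    apply E.injective
    ext q
    obtain ⟨g, rfl⟩ := QuotientGroup.mk_surjective q
    rw [← hφ, ← hφ, h1]
  · intro ⟨y, hy⟩
    refine ⟨E.symm (MonoidAlgebra.ofCoeff (Finsupp.equivFunOnFinite.symm
      fun q => y.coeff q.out)), ?_⟩
    apply Subtype.ext
    change φ _ = y
    ext g
    rw [hφ, LinearEquiv.apply_symm_apply]
    change y.coeff (QuotientGroup.mk g : G ⧸ N).out = y.coeff g
    obtain ⟨n, hn⟩ := QuotientGroup.mk_out_eq_mul N g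
    rw [hn, (h y).1 hy g n n.2]

end RegularModule

section PermModule

open MonoidAlgebra

theorem higman_summand {k G X V : Type} [Field k] [Group G] [Fintype G] [AddCommGroup X]
    [Module k X] [Module (MonoidAlgebra k G) X] [IsScalarTower k (MonoidAlgebra k G) X]
    [AddCommGroup V] [Module (MonoidAlgebra k G) V]
    (r : X →ₗ[MonoidAlgebra k G] V) (j : V →ₗ[MonoidAlgebra k G] X) (hrj : ∀ v, r (j v) = v)
    (θ0 : X →ₗ[k] X) (c : k) (hc : c ≠ 0)
    (h : ∀ x, r x = 0 → ∑ g : G, θ0.conjugate g x = c • x) :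
    Module.Projective (MonoidAlgebra k G) (LinearMap.ker r) := by
  let ρ0 : X →ₗ[MonoidAlgebra k G] X := LinearMap.id - j ∘ₗ r
  have hρ0 : ∀ x, ρ0 x = x - j (r x) := fun x => rfl
  let ρ : X →ₗ[MonoidAlgebra k G] LinearMap.ker r := ρ0.codRestrict (LinearMap.ker r) (by
    intro x
    rw [LinearMap.mem_ker, hρ0, map_sub, hrj, sub_self])
  have hρ : ∀ x : LinearMap.ker r, ρ x = x := by
    intro x
    apply Subtype.ext
    change ρ0 x = x
    rw [hρ0, LinearMap.mem_ker.1 x.2, map_zero, sub_zero]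
  let θ : LinearMap.ker r →ₗ[k] LinearMap.ker r :=
    (ρ.restrictScalars k) ∘ₗ (c⁻¹ • θ0) ∘ₗ ((LinearMap.ker r).subtype.restrictScalars k)
  have hθ : ∀ x, θ x = ρ (c⁻¹ • θ0 x) := fun x => rfl
  refine higman_proj θ fun x => ?_
  have h6 : ∀ g : G, θ.conjugate g x = ρ (c⁻¹ • θ0.conjugate g (x : X)) := by
    intro g
    rw [LinearMap.conjugate_apply, LinearMap.conjugate_apply, hθ, ← ρ.map_smul, smul_comm]
    rfl
  simp_rw [h6]
  rw [← map_sum, ← Finset.smul_sum, h x (LinearMap.mem_ker.1 x.2), smul_smul,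
    inv_mul_cancel₀ hc, one_smul, hρ]

set_option maxHeartbeats 1000000 in
theorem perm_split {k G : Type} [Field k] [Group G] [Fintype G] (p : ℕ) [hp : Fact p.Prime]
    [CharP k p] (N : Subgroup G)
    (σ : G) (hσN : σ ∈ N) (hσp : σ ^ p = 1) (hσ1 : σ ≠ 1) (hpp : ¬ p ^ 2 ∣ Fintype.card G)
    (hfix : ∀ q : G ⧸ N, σ • q = q → q = QuotientGroup.mk 1) :
    ∃ P : ModuleCat.{0} (MonoidAlgebra k G), Module.Projective (MonoidAlgebra k G) P ∧
      Nonempty ((Representation.ofMulAction k G (G ⧸ N)).asModule ≃ₗ[MonoidAlgebra k G]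
        ((ModuleCat.of (MonoidAlgebra k G)
            (Representation.trivial k (G := G) (V := k)).asModule) × P)) := by
  classical
  have := Fintype.ofFinite (G ⧸ N)
  have := Fintype.ofFinite N
  let X := (Representation.ofMulAction k G (G ⧸ N)).asModule
  let E : X ≃ₗ[k] MonoidAlgebra k (G ⧸ N) :=
    (Representation.ofMulAction k G (G ⧸ N)).asModuleEquiv
  let V := (Representation.trivial k (G := G) (V := k)).asModule
  let ET : V ≃ₗ[k] k := (Representation.trivial k (G := G) (V := k)).asModuleEquiv
  have hE : ∀ (g : G) (x : X) q, (E (single g (1 : k) • x)).coeff q = (E x).coeff (g⁻¹ • q) :=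
    fun g x q => perm_coeff N x g q
  have hET : ∀ (g : G) (v : V), single g (1 : k) • v = v := by
    intro g v
    rw [Representation.single_smul]
    simp
    rfl
  -- number of cosets
  have hcard : ((Fintype.card (G ⧸ N) : ℕ) : k) = 1 := by
    have hci : ∀ i x, ((MulAction.toPerm σ : Equiv.Perm (G ⧸ N)) ^ i) x = σ ^ i • x := by
      intro i x
      induction i with
      | zero => simp
      | succ i ih => rw [pow_succ', Equiv.Perm.mul_apply, ih, pow_succ', mul_smul]; rfl
    obtain ⟨d, hd⟩ := card_quot p hp.out (MulAction.toPerm σ : Equiv.Perm (G ⧸ N))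
      (by ext x; rw [hci, hσp]; simp) (QuotientGroup.mk 1)
      (by
        change σ • (QuotientGroup.mk 1 : G ⧸ N) = _
        rw [MulAction.Quotient.smul_mk, QuotientGroup.eq]
        simpa using hσN) hfix
    rw [hd]; simp
  let r0 : X →ₗ[k] V :=
    { toFun := fun x => ET.symm (∑ q, (E x).coeff q)
      map_add' := by
        intro x y
        rw [← map_add, ← Finset.sum_add_distrib]
        simp
      map_smul' := by
        intro c x
        rw [RingHom.id_apply, ← map_smul, Finset.smul_sum]
        simp }
  have hr0 : ∀ x, r0 x = ET.symm (∑ q, (E x).coeff q) := fun x => rfl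
  let r := MonoidAlgebra.equivariantOfLinearOfComm r0 (by
    intro g x
    rw [hET, hr0, hr0]
    congr 1
    simp_rw [hE]
    exact Equiv.sum_comp (MulAction.toPerm g⁻¹ : Equiv.Perm (G ⧸ N)) (fun q => (E x).coeff q))
  have hr : ∀ x, r x = ET.symm (∑ q, (E x).coeff q) := fun x => rfl
  let j0 : V →ₗ[k] X :=
    { toFun := fun v => E.symm (MonoidAlgebra.ofCoeff (Finsupp.equivFunOnFinite.symm
        fun q => ET v))
      map_add' := by
        intro x y
        rw [← map_add]
        congr 1
        ext q
        simp
      map_smul' := by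
        intro c x
        rw [RingHom.id_apply, ← map_smul]
        congr 1
        ext q
        simp }
  have hj0 : ∀ v q, (E (j0 v)).coeff q = ET v := fun v q => rfl
  let j := MonoidAlgebra.equivariantOfLinearOfComm j0 (by
    intro g v
    apply E.injective
    ext q
    rw [hET, hj0, hE, hj0])
  have hj : ∀ v q, (E (j v)).coeff q = ET v := fun v q => rfl
  have hrj : ∀ v, r (j v) = v := by
    intro v
    rw [hr]
    simp_rw [hj]
    rw [Finset.sum_const, Finset.card_univ, ← Nat.cast_smul_eq_nsmul k, hcard, one_smul]
    simp
  obtain ⟨e⟩ := split_equiv r j hrj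
  refine ⟨ModuleCat.of _ (LinearMap.ker r), ?_, ⟨e⟩⟩
  change Module.Projective (MonoidAlgebra k G) (LinearMap.ker r)
  obtain ⟨t, κ, hκ, ht1, ht⟩ := stab_sum p hp.out N σ hσN hσp hσ1 hpp hfix
  have hκ0 : (κ : k) ≠ 0 := fun h => hκ ((CharP.cast_eq_zero_iff k p κ).1 h)
  let b : X := E.symm (single (QuotientGroup.mk 1) (1 : k))
  have hb : ∀ q, (E b).coeff q = if q = QuotientGroup.mk 1 then 1 else 0 := by
    intro q
    change (Finsupp.single _ _ : _ →₀ k) q = _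
    rw [Finsupp.single_apply]
    simp only [eq_comm]
  let lam : X →ₗ[k] k :=
    { toFun := fun x => ∑ q, (t q : k) * (E x).coeff q
      map_add' := by
        intro x y
        rw [← Finset.sum_add_distrib]
        simp [mul_add]
      map_smul' := by
        intro c x
        rw [RingHom.id_apply, Finset.smul_sum]
        simp [mul_left_comm] }
  have hlam : ∀ x, lam x = ∑ q, (t q : k) * (E x).coeff q := fun x => rfl
  let θ0 : X →ₗ[k] X := LinearMap.toSpanSingleton k X b ∘ₗ lam
  have hθ0 : ∀ x, θ0 x = lam x • b := fun x => rfl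
  have key : ∀ (x : X) (q0 : G ⧸ N),
      (E (∑ g : G, θ0.conjugate g x)).coeff q0 =
        (κ : k) * (∑ q, (E x).coeff q - (E x).coeff q0) := by
    intro x q0
    obtain ⟨h, rfl⟩ := QuotientGroup.mk_surjective q0
    rw [map_sum, coeff_sum, Finsupp.finsetSum_apply]
    have h1 : ∀ g : G, (E (θ0.conjugate g x)).coeff (QuotientGroup.mk h) =
        if (g * h) ∈ N then lam (single g (1 : k) • x) else 0 := by
      intro g
      rw [LinearMap.conjugate_apply, hE, hθ0, E.map_smul, coeff_smul_apply, hb, inv_inv,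
        MulAction.Quotient.smul_mk]
      have : ((QuotientGroup.mk (g • h) : G ⧸ N) = QuotientGroup.mk 1) ↔ g * h ∈ N := by
        rw [eq_comm, QuotientGroup.eq]; simp
      simp only [this]
      split_ifs <;> simp
    simp_rw [h1]
    have h2 : ∑ g : G, (if (g * h) ∈ N then lam (single g (1 : k) • x) else 0)
        = ∑ n : N, lam (single ((n : G) * h⁻¹) (1 : k) • x) := by
      rw [← Equiv.sum_comp (Equiv.mulRight h⁻¹)]
      simp only [Equiv.coe_mulRight, inv_mul_cancel_right]
      rw [← Finset.sum_filter]
      exact (Finset.sum_subtype _ (by simp) _)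
    rw [h2]
    have h3 : ∀ n : N, lam (single ((n : G) * h⁻¹) (1 : k) • x)
        = ∑ q, (t ((n : G) • q) : k) * (E x).coeff (h • q) := by
      intro n
      rw [hlam, ← Equiv.sum_comp (MulAction.toPerm (n : G) : Equiv.Perm (G ⧸ N))]
      refine Finset.sum_congr rfl fun q _ => ?_
      rw [hE]
      simp [smul_smul]
    simp_rw [h3]
    rw [Finset.sum_comm]
    simp_rw [← Finset.sum_mul, ← Nat.cast_sum]
    rw [← Equiv.sum_comp (MulAction.toPerm h : Equiv.Perm (G ⧸ N)) (fun q => (E x).coeff q)]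
    rw [← Finset.add_sum_erase _ _ (Finset.mem_univ (QuotientGroup.mk 1 : G ⧸ N)),
      ← Finset.add_sum_erase _ (fun q => (E x).coeff ((MulAction.toPerm h) q))
        (Finset.mem_univ (QuotientGroup.mk 1 : G ⧸ N))]
    have h4 : ∑ n : N, t ((n : G) • (QuotientGroup.mk 1 : G ⧸ N)) = 0 := by
      refine Finset.sum_eq_zero fun n _ => ?_
      rw [← ht1]
      congr 1
      rw [MulAction.Quotient.smul_mk, eq_comm, QuotientGroup.eq]
      simp
    have h5 : (MulAction.toPerm h) (QuotientGroup.mk 1 : G ⧸ N) = QuotientGroup.mk h := by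
      change h • (QuotientGroup.mk 1 : G ⧸ N) = _
      rw [MulAction.Quotient.smul_mk]; simp
    rw [h4, h5, Nat.cast_zero, zero_mul, zero_add, add_sub_cancel_left, Finset.mul_sum]
    refine Finset.sum_congr rfl fun q hq => ?_
    rw [ht q (Finset.ne_of_mem_erase hq)]
    rfl
  refine higman_summand r j hrj θ0 (-(κ : k)) (neg_ne_zero.2 hκ0) fun x hx => ?_
  apply E.injective
  ext q
  rw [key, E.map_smul, coeff_smul_apply]
  have : ∑ q, (E (x : X)).coeff q = 0 := by
    rw [hr] at hx
    exact ET.symm.map_eq_zero_iff.1 hx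
  rw [this, smul_eq_mul]; ring

end PermModule

section SymFacts

theorem semiconj_pow_aux {G : Type} [Group G] (n s : G) (b : ℕ) (h : SemiconjBy n s (s ^ b))
    (i : ℕ) : SemiconjBy (n ^ i) s (s ^ (b ^ i)) := by
  induction i with
  | zero => simp
  | succ i ih =>
    rw [pow_succ', pow_succ', pow_mul]
    exact SemiconjBy.mul_left (h.pow_right (b ^ i)) ih

theorem sym_facts (p : ℕ) [hp : Fact p.Prime] (σ : Equiv.Perm (Fin p)) (hσ : σ.IsCycle)
    (hsupp : σ.support.card = p) :
    ∃ (a : (ZMod p)ˣ) (τ : Equiv.Perm (Fin p)), orderOf a = p - 1 ∧ τ ^ (p - 1) = 1 ∧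
      τ * σ = σ ^ (a : ZMod p).val * τ ∧
      ∀ q : Equiv.Perm (Fin p) ⧸ Subgroup.closure {σ, τ}, σ • q = q → q = QuotientGroup.mk 1 := by
  classical
  have hord : orderOf σ = p := by rw [hσ.orderOf, hsupp]
  have hσp : σ ^ p = 1 := orderOf_dvd_iff_pow_eq_one.1 hord.dvd
  have hz : ∀ m n : ℕ, σ ^ m = σ ^ n ↔ (m : ZMod p) = n := by
    intro m n
    rw [pow_eq_pow_iff_modEq, hord, ZMod.natCast_eq_natCast_iff]
  have hmove : ∀ x, σ x ≠ x := by
    intro x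
    have h1 : σ.support = Finset.univ := by
      rw [← Finset.card_eq_iff_eq_univ, hsupp, Fintype.card_fin]
    have h2 : x ∈ σ.support := by rw [h1]; exact Finset.mem_univ x
    exact Equiv.Perm.mem_support.1 h2
  have hcent : ∀ g, SemiconjBy g σ σ → ∃ j : ℕ, g = σ ^ j := by
    intro g hg
    let x0 : Fin p := ⟨0, hp.out.pos⟩
    obtain ⟨i, hi⟩ := hσ.exists_pow_eq (hmove x0) (hmove (g x0))
    refine ⟨i, Equiv.ext fun x => ?_⟩
    obtain ⟨j, rfl⟩ := hσ.exists_pow_eq (hmove x0) (hmove x)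
    have h1 : g * σ ^ j = σ ^ j * g := hg.pow_right j
    rw [← Equiv.Perm.mul_apply, h1, Equiv.Perm.mul_apply, ← hi, ← Equiv.Perm.mul_apply,
      ← Equiv.Perm.mul_apply, ← pow_add, ← pow_add, add_comm]
  obtain ⟨a, ha⟩ := IsCyclic.exists_generator (α := (ZMod p)ˣ)
  have haord : orderOf a = p - 1 := by
    rw [orderOf_eq_card_of_forall_mem_zpowers ha, Nat.card_eq_fintype_card, ZMod.card_units]
  have hav0 : (a : ZMod p).val ≠ 0 := by
    rw [Ne, ZMod.val_eq_zero]; exact a.ne_zero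
  have havlt : (a : ZMod p).val < p := ZMod.val_lt _
  have hcyc : (σ ^ (a : ZMod p).val).IsCycle :=
    hσ.isCycle_pow_pos_of_lt_prime_order (by rw [hord]; exact hp.out) _ (Nat.pos_of_ne_zero hav0)
      (by rw [hord]; exact havlt)
  have hconj : IsConj σ (σ ^ (a : ZMod p).val) := by
    refine hσ.isConj hcyc ?_
    rw [← hσ.orderOf, ← hcyc.orderOf]
    rw [Nat.Coprime.orderOf_pow]
    rw [hord]
    exact Nat.coprime_of_lt_prime (by omega) havlt hp.out
  obtain ⟨τ0, hτ0⟩ := isConj_iff.1 hconj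
  have h0 : SemiconjBy τ0 σ (σ ^ (a : ZMod p).val) := by
    change τ0 * σ = _ * τ0
    rw [← hτ0]; group
  have hva : (((a : ZMod p).val : ℕ) : ZMod p) = a := ZMod.natCast_zmod_val _
  have h1 : SemiconjBy (τ0 ^ (p - 1)) σ σ := by
    have := semiconj_pow_aux _ _ _ h0 (p - 1)
    have h2 : σ ^ ((a : ZMod p).val ^ (p - 1)) = σ ^ 1 := by
      rw [hz, Nat.cast_pow, hva, ← Units.val_pow_eq_pow_val, ← haord, pow_orderOf_eq_one]; simp
    rwa [h2, pow_one] at this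
  obtain ⟨j, hj⟩ := hcent _ h1
  have h2 : SemiconjBy (τ0 ^ p) σ (σ ^ (a : ZMod p).val) := by
    have := semiconj_pow_aux _ _ _ h0 p
    have h2 : σ ^ ((a : ZMod p).val ^ p) = σ ^ (a : ZMod p).val := by
      rw [hz, Nat.cast_pow, hva, ZMod.pow_card]
    rwa [h2] at this
  refine ⟨a, τ0 ^ p, haord, ?_, h2, ?_⟩
  · rw [← pow_mul, mul_comm, pow_mul, hj, ← pow_mul, mul_comm, pow_mul, hσp, one_pow]
  set τ := τ0 ^ p with hτ
  have hσN : σ ∈ Subgroup.closure {σ, τ} := Subgroup.subset_closure (by simp)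
  have hτN : τ ∈ Subgroup.closure {σ, τ} := Subgroup.subset_closure (by simp)
  have hN : ∀ n ∈ Subgroup.closure {σ, τ}, ∃ b : ℕ, SemiconjBy n σ (σ ^ b) := by
    intro n hn
    induction hn using Subgroup.closure_induction with
    | mem x hx =>
      rcases hx with rfl | hx
      · exact ⟨1, by simp [SemiconjBy]⟩
      · rw [Set.mem_singleton_iff] at hx
        subst hx
        exact ⟨_, h2⟩
    | one => exact ⟨1, by simp⟩
    | mul x y _ _ hx hy =>
      obtain ⟨b, hb⟩ := hx
      obtain ⟨c, hc⟩ := hy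
      refine ⟨b * c, ?_⟩
      rw [pow_mul]
      exact SemiconjBy.mul_left (hb.pow_right c) hc
    | inv x _ hx =>
      obtain ⟨b, hb⟩ := hx
      obtain ⟨k, hk⟩ := mem_powers_iff_mem_zpowers.2 (inv_mem (Subgroup.mem_zpowers x))
      have hk' : x ^ k = x⁻¹ := hk
      refine ⟨b ^ k, ?_⟩
      rw [← hk']
      exact semiconj_pow_aux _ _ _ hb k
  intro q hq
  obtain ⟨g, rfl⟩ := QuotientGroup.mk_surjective q
  have hn : g⁻¹ * σ * g ∈ Subgroup.closure {σ, τ} := by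
    rw [MulAction.Quotient.smul_mk, eq_comm, QuotientGroup.eq] at hq
    simpa [mul_assoc] using hq
  obtain ⟨b, hb⟩ := hN _ hn
  have hnp : (g⁻¹ * σ * g) ^ p = 1 := by
    have := conj_pow (a := g⁻¹) (b := σ) (i := p)
    rw [inv_inv] at this
    rw [this, hσp]; simp
  have hb1 : σ ^ b = σ := by
    have h3 := semiconj_pow_aux _ _ _ hb p
    rw [hnp] at h3
    have h4 : σ ^ 1 = σ ^ (b ^ p) := by simpa [SemiconjBy] using h3
    rw [hz, Nat.cast_pow, ZMod.pow_card] at h4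
    have h5 := (hz 1 b).2 h4
    rw [← h5, pow_one]
  rw [hb1] at hb
  obtain ⟨j, hj⟩ := hcent _ hb
  have h3 : SemiconjBy g (σ ^ j) σ := by
    change g * σ ^ j = σ * g
    rw [← hj]; group
  have hj0 : (j : ZMod p) ≠ 0 := by
    intro h
    have h4 : σ ^ j = σ ^ 0 := (hz j 0).2 (by simpa using h)
    rw [pow_zero] at h4
    rw [h4] at h3
    have h5 : σ = 1 := by
      have h6 : g * 1 = σ * g := h3
      rw [mul_one] at h6
      exact (mul_eq_right.1 h6.symm)
    exact hσ.ne_one h5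
  obtain ⟨i, hi⟩ := mem_powers_iff_mem_zpowers.2 (ha (Units.mk0 (j : ZMod p) hj0))
  have hi' : a ^ i = Units.mk0 (j : ZMod p) hj0 := hi
  have h4 : σ ^ j = σ ^ ((a : ZMod p).val ^ i) := by
    rw [hz, Nat.cast_pow, hva, ← Units.val_pow_eq_pow_val, hi', Units.val_mk0]
  have h5 := semiconj_pow_aux _ _ _ h2 i
  rw [← h4] at h5
  obtain ⟨l, hl⟩ := hcent _ (SemiconjBy.mul_left h3 h5)
  rw [eq_comm, QuotientGroup.eq, inv_one, one_mul]
  have : g = σ ^ l * (τ ^ i)⁻¹ := by rw [← hl]; group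
  rw [this]
  exact mul_mem (pow_mem hσN _) (inv_mem (pow_mem hτN _))

theorem fact_sq (p : ℕ) (hp : p.Prime) : ¬ p ^ 2 ∣ p.factorial := by
  intro h
  obtain ⟨n, rfl⟩ : ∃ n, p = n + 1 := ⟨p - 1, by have := hp.pos; omega⟩
  rw [Nat.factorial_succ, pow_two] at h
  have := Nat.dvd_of_mul_dvd_mul_left hp.pos h
  rw [hp.dvd_factorial] at this
  omega

end SymFacts

/-- Let `p` be an odd prime, `F` algebraically closed of characteristic
`p`, and `C_p = ⟨σ⟩ ≤ 𝔖_p` cyclic of order `p` generated by a `p`-cycle `σ`.  Then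
`Ind_{C_p}^{𝔖_p} F ≅ F ⊕ Ω²(F) ⊕ ⋯ ⊕ Ω^{2p-4}(F) ⊕ P` for some projective
`F𝔖_p`-module `P`.  (`Ind_{C_p}^{𝔖_p} F` is the permutation module `F[𝔖_p/C_p]`, and the
`K m ≅ Ω^{2m}(F)` for `0 ≤ m ≤ p-2` are the `p-1` non-projective summands.) -/
theorem induced_trivial_from_cyclic_decomposition
    (p : ℕ) [hp : Fact p.Prime] (hodd : Odd p)
    (F : Type) [Field F] [IsAlgClosed F] [CharP F p]
    (σ : Equiv.Perm (Fin p)) (hσ : σ.IsCycle) (hsupp : σ.support.card = p) :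
    ∃ (K : Fin (p - 1) → ModuleCat.{0} (MonoidAlgebra F (Equiv.Perm (Fin p))))
      (P : ModuleCat.{0} (MonoidAlgebra F (Equiv.Perm (Fin p)))),
      Module.Projective (MonoidAlgebra F (Equiv.Perm (Fin p))) P ∧
      (∀ m : Fin (p - 1),
        isOmegaPow (2 * (m : ℕ))
          (ModuleCat.of (MonoidAlgebra F (Equiv.Perm (Fin p)))
            (Representation.trivial F (G := Equiv.Perm (Fin p)) (V := F)).asModule)
          (K m)) ∧
      Nonempty
        ((Representation.ofMulAction F (Equiv.Perm (Fin p))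
            (Equiv.Perm (Fin p) ⧸ Subgroup.zpowers σ)).asModule
          ≃ₗ[MonoidAlgebra F (Equiv.Perm (Fin p))]
            ((∀ m : Fin (p - 1), ↥(K m)) × ↥P)) := by
  classical
  obtain ⟨a, τ, ha, hτp, hτσ, hfix⟩ := sym_facts p σ hσ hsupp
  have hord : orderOf σ = p := by rw [hσ.orderOf, hsupp]
  have hσp : σ ^ p = 1 := orderOf_dvd_iff_pow_eq_one.1 hord.dvd
  have hcardG : Fintype.card (Equiv.Perm (Fin p)) = p.factorial := by
    rw [Fintype.card_perm, Fintype.card_fin]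
  have hcard0 : ((Fintype.card (Equiv.Perm (Fin p)) : ℕ) : F) = 0 := by
    rw [hcardG, CharP.cast_eq_zero_iff F p, hp.out.dvd_factorial]
  have hσN : σ ∈ Subgroup.closure {σ, τ} := Subgroup.subset_closure (by simp)
  have hτN : τ ∈ Subgroup.closure {σ, τ} := Subgroup.subset_closure (by simp)
  let ζ : F := ZMod.castHom (dvd_refl p) F (a : ZMod p)
  have hζ : IsPrimitiveRoot ζ (p - 1) := by
    have h1 : IsPrimitiveRoot a (p - 1) := by rw [← ha]; exact IsPrimitiveRoot.orderOf a
    exact (IsPrimitiveRoot.coe_units_iff.2 h1).map_of_injective (RingHom.injective _)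
  obtain ⟨P0, hP0, ⟨e1⟩⟩ := perm_split (k := F) p (Subgroup.closure {σ, τ}) σ hσN hσp hσ.ne_one
    (by rw [hcardG]; exact fact_sq p hp.out) hfix
  have hfixpow : ∀ (g : Equiv.Perm (Fin p)) (x : MonoidAlgebra F (Equiv.Perm (Fin p))),
      rmul F g x = x ↔ ∀ h, x.coeff (h * g) = x.coeff h := by
    intro g x
    constructor
    · intro hx h
      conv_lhs => rw [← hx]
      rw [rmul_coeff, mul_inv_cancel_right]
    · intro hx
      ext h
      rw [rmul_coeff, ← hx, inv_mul_cancel_right]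
  have hinv : ∀ (x : MonoidAlgebra F (Equiv.Perm (Fin p))) (s : Set (Equiv.Perm (Fin p))),
      (∀ n ∈ s, rmul F n x = x) →
        ∀ g, ∀ n ∈ Subgroup.closure s, x.coeff (g * n) = x.coeff g := by
    intro x s hs g n hn
    induction hn using Subgroup.closure_induction generalizing g with
    | mem n hn => exact (hfixpow n x).1 (hs n hn) g
    | one => rw [mul_one]
    | mul m n _ _ hm hn => rw [← mul_assoc, hn, hm]
    | inv n _ hn => rw [← hn, inv_mul_cancel_right]
  obtain ⟨e2⟩ := inv_equiv (k := F) (Subgroup.closure {σ, τ}) (xsub F ζ (rmul F σ) (rmul F τ) 0) (by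
    intro x
    rw [xsub, Submodule.mem_inf, mem_fix, mem_ysub, pow_zero, one_smul]
    constructor
    · rintro ⟨h1, h2⟩
      refine hinv x _ ?_
      rintro n (rfl | hn)
      · exact h1
      · rw [Set.mem_singleton_iff] at hn
        rw [hn]; exact h2
    · intro h
      exact ⟨(hfixpow σ x).2 fun g => h g σ hσN, (hfixpow τ x).2 fun g => h g τ hτN⟩)
  obtain ⟨e3⟩ := inv_equiv (k := F) (Subgroup.zpowers σ) (LinearMap.ker (rmul F σ - 1)) (by
    intro x
    rw [mem_fix, Subgroup.zpowers_eq_closure]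
    constructor
    · intro h1
      refine hinv x _ ?_
      intro n hn
      rw [Set.mem_singleton_iff] at hn
      rw [hn]; exact h1
    · intro h
      exact (hfixpow σ x).2 fun g => h g σ (Subgroup.subset_closure rfl))
  have : IsArtinianRing (MonoidAlgebra F (Equiv.Perm (Fin p))) :=
    IsArtinianRing.of_finite F _
  obtain ⟨K, P, hP, hK, ⟨e⟩⟩ := main_abstract p F (A := MonoidAlgebra F (Equiv.Perm (Fin p)))
    (M := MonoidAlgebra F (Equiv.Perm (Fin p))) projSubSplit_group hodd ζ hζ (rmul F σ) (rmul F τ)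
    (by rw [rmul_pow, hσp, rmul_one]) (by rw [rmul_pow, hτp, rmul_one]) a rfl
    (by rw [rmul_pow, ← rmul_mul, ← rmul_mul, hτσ])
    (reg_h1 p hp.out σ hσp hσ.ne_one) (reg_h2 p hp.out σ hσp hσ.ne_one)
    (ModuleCat.of _ (Representation.trivial F (G := Equiv.Perm (Fin p)) (V := F)).asModule) P0 hP0
    (trivial_noProj hcard0) (e2.symm.trans e1)
  exact ⟨K, P, hP, hK, ⟨e3.trans e⟩⟩
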